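/- arXiv:1107.5730 — 2 statements merged into one kernel-verified Lean document; each statement's English description precedes it below -/
import Mathlib

section
/- (Matched filter state evolution.) Let X ∈ ℝ^n have support uniform over size-k subsets with i.i.d. N(0,1) nonzero values, let Y = √(SNR/k)·A X + W with A an m×n matrix with i.i.d. N(0,1) entries and W ~ N(0, I_m) independent, and let the matched filter estimate be X̂^MF = (1/m)·√(k/SNR)·Aᵀ Y. Then, as n → ∞ with k/n → κ ∈ (0,1/2) and m/n → r > 0, the empirical joint distribution of the pairs (X(i), X̂^MF(i)), i = 1,…,n, converges weakly, almost surely, to the distribution of (X̄, X̄ + σ·W̄), where X̄ ~ F_κ and W̄ ~ N(0,1) are independent and σ² = (κ/r)·(1/SNR + 1). -/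
open MeasureTheory ProbabilityTheory Real Filter Finset Topology
open scoped ENNReal NNReal

noncomputable section

namespace Sparsity

/-- Binary entropy function (natural logarithms). -/
def Hb (p : ℝ) : ℝ := -(p * Real.log p) - (1 - p) * Real.log (1 - p)

/-- The metric entropy rate `R(κ, α)`. -/
def Rrate (κ α : ℝ) : ℝ :=
  if α < 1 - κ then Hb κ - κ * Hb α - (1 - κ) * Hb (κ * α / (1 - κ)) else 0

/-- The standard gaussian measure on `ℝ`. -/
def stdGaussian : Measure ℝ := gaussianReal 0 1

instance : IsProbabilityMeasure stdGaussian := by unfold stdGaussian; infer_instance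

/-- i.i.d. standard gaussian measure on `ι → ℝ`. -/
def gaussianPi (ι : Type*) [Fintype ι] : Measure (ι → ℝ) := Measure.pi fun _ => stdGaussian

instance (ι : Type*) [Fintype ι] : IsProbabilityMeasure (gaussianPi ι) := by
  unfold gaussianPi; infer_instance

/-- CDF of a normalized chi-square with `J` degrees of freedom,
i.e. the law of `(1/J) ∑_{j<J} U_j^2` with `U_j` i.i.d. standard gaussian. -/
def chiCDF (J : ℕ) (t : ℝ) : ℝ :=
  ((gaussianPi (Fin J)) {u | ∑ j, (u j) ^ 2 ≤ J * t}).toReal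

/-- Quantile function `ξ_J` of the normalized chi-square with `J` degrees of freedom. -/
def xi (J : ℕ) (p : ℝ) : ℝ := sInf {t : ℝ | 0 ≤ t ∧ p ≤ chiCDF J t}

/-- The diversity power `P_J(β) = ∫_0^β ξ_J(p) dp`. -/
def Ppow (J : ℕ) (β : ℝ) : ℝ := ∫ p in (0:ℝ)..β, xi J p

/-- All sparsity patterns: size-`k` subsets of `{1,…,n}`. -/
def patterns (n k : ℕ) : Finset (Finset (Fin n)) := Finset.powersetCard k Finset.univ

/-- The underlying randomness for the joint sparsity model: nonzero values `ω.1`,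
measurement matrices `ω.2.1`, and additive noise `ω.2.2`. -/
abbrev Omega (n m J : ℕ) : Type :=
  (Fin J → Fin n → ℝ) × (Fin J → Fin m → Fin n → ℝ) × (Fin J → Fin m → ℝ)

/-- The law of the randomness: everything i.i.d. standard gaussian. -/
def omegaLaw (n m J : ℕ) : Measure (Omega n m J) :=
  (Measure.pi fun _ : Fin J => gaussianPi (Fin n)).prod
    ((Measure.pi fun _ : Fin J => Measure.pi fun _ : Fin m => gaussianPi (Fin n)).prod
      (Measure.pi fun _ : Fin J => gaussianPi (Fin m)))

/-- The sparse signal with pattern `S` and nonzero values `x`. -/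
def signal (n : ℕ) (S : Finset (Fin n)) (x : Fin n → ℝ) : Fin n → ℝ :=
  fun i => if i ∈ S then x i else 0

/-- The noisy observations `Y_j = √(SNR/k)·A_j X_j + W_j`. -/
def Yobs (n m J : ℕ) (SNR : ℝ) (k : ℕ) (S : Finset (Fin n)) (ω : Omega n m J) :
    Fin J → Fin m → ℝ :=
  fun j r =>
    Real.sqrt (SNR / k) * (∑ i, ω.2.1 j r i * signal n S (ω.1 j) i) + ω.2.2 j r

/-- Normalized distortion `d(S,T) = max(|S∖T|, |T∖S|)/k`. -/
def distor (k : ℕ) {n : ℕ} (S T : Finset (Fin n)) : ℝ :=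
  (max (S \ T).card (T \ S).card : ℝ) / k

/-- A sparsity pattern estimator: a function of the observations `(Y_j)_j`
and of the measurement matrices `(A_j)_j`. -/
abbrev Estimator (n m J : ℕ) : Type :=
  (Fin J → Fin m → ℝ) → (Fin J → Fin m → Fin n → ℝ) → Finset (Fin n)

/-- The probability that the estimator `est` makes distortion larger than `α`,
averaged over the uniformly distributed sparsity pattern. -/
def errProb (n m J k : ℕ) (SNR α : ℝ) (est : Estimator n m J) : ℝ :=
  (n.choose k : ℝ)⁻¹ * ∑ S ∈ patterns n k,
    (omegaLaw n m J
      {ω | α < distor k S (est (Yobs n m J SNR k S ω) ω.2.1)}).toReal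

/-- Distortion `α` is achievable (by some estimator sequence) at sparsity rate `κ`,
signal-to-noise ratio `SNR`, total sampling rate `ρ` and diversity `J`. -/
def achievable (κ SNR ρ : ℝ) (J : ℕ) (α : ℝ) : Prop :=
  ∃ (k m : ℕ → ℕ) (est : ∀ n, Estimator n (m n) J),
    Tendsto (fun n => (k n : ℝ) / n) atTop (𝓝 κ) ∧
    Tendsto (fun n => (J : ℝ) * (m n) / n) atTop (𝓝 ρ) ∧
    Tendsto (fun n => errProb n (m n) J (k n) SNR α (est n)) atTop (𝓝 0)

/-- The infimum total sampling rate at which distortion `α` is achievable. -/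
def rhoStar (κ SNR : ℝ) (J : ℕ) (α : ℝ) : ℝ := sInf {ρ | achievable κ SNR ρ J α}

end Sparsity

namespace Sparsity

instance (n : ℕ) : MeasurableSpace (Finset (Fin n)) := ⊤

/-- The uniform distribution on the size-`k` subsets of `{1,…,n}`. -/
def uniformPatterns (n k : ℕ) : Measure (Finset (Fin n)) :=
  ((patterns n k).card : ℝ≥0∞)⁻¹ • ∑ S ∈ patterns n k, Measure.dirac S

instance (n k : ℕ) : SFinite (uniformPatterns n k) := by
  unfold uniformPatterns; infer_instance

/-- Sample space for the single-vector (`J = 1`) model: the sparsity pattern, the nonzero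
values, the measurement matrix, and the noise. -/
abbrev MFSpace (n m : ℕ) : Type :=
  Finset (Fin n) × (Fin n → ℝ) × (Fin m → Fin n → ℝ) × (Fin m → ℝ)

/-- The law of the single-vector model: `S` uniform on size-`k` subsets, and the nonzero
values, matrix entries and noise all i.i.d. standard gaussian, independent. -/
def mfLaw (n m k : ℕ) : Measure (MFSpace n m) :=
  (uniformPatterns n k).prod
    ((gaussianPi (Fin n)).prod
      ((Measure.pi fun _ : Fin m => gaussianPi (Fin n)).prod (gaussianPi (Fin m))))

/-- The sparse vector `X`. -/
def Xvec (n m : ℕ) (ω : MFSpace n m) : Fin n → ℝ := signal n ω.1 ω.2.1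

/-- The observation `Y = √(SNR/k)·A X + W`. -/
def Yvec (n m : ℕ) (SNR : ℝ) (k : ℕ) (ω : MFSpace n m) : Fin m → ℝ :=
  fun r => Real.sqrt (SNR / k) * (∑ i, ω.2.2.1 r i * Xvec n m ω i) + ω.2.2.2 r

/-- The matched filter estimate `X̂ = (1/m)·√(k/SNR)·Aᵀ Y`. -/
def mfEst (n m : ℕ) (SNR : ℝ) (k : ℕ) (ω : MFSpace n m) : Fin n → ℝ :=
  fun i => (1 / m) * Real.sqrt (k / SNR) * ∑ r, ω.2.2.1 r i * Yvec n m SNR k ω r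

/-- Empirical joint distribution of the pairs `(x i, x̂ i)`. -/
def empirical (n : ℕ) (x xhat : Fin n → ℝ) : Measure (ℝ × ℝ) :=
  (n : ℝ≥0∞)⁻¹ • ∑ i : Fin n, Measure.dirac (x i, xhat i)

/-- The sparse gaussian distribution `F_κ`: `0` with probability `1−κ`, standard gaussian
with probability `κ`. -/
def sparseGaussian (κ : ℝ) : Measure ℝ :=
  ENNReal.ofReal (1 - κ) • Measure.dirac 0 + ENNReal.ofReal κ • stdGaussian

/-- The law of the pair `(X̄, X̄ + σ·W̄)` where `X̄ ∼ F_κ` and `W̄ ∼ N(0,1)` are independent. -/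
def mfLimit (κ σ : ℝ) : Measure (ℝ × ℝ) :=
  ((sparseGaussian κ).prod stdGaussian).map fun p => (p.1, p.1 + σ * p.2)

/-- Weak convergence of probability measures can be tested on a countable family of Lipschitz
functions. -/
theorem exists_countable_lipschitz_tests (α : Type*) [PseudoEMetricSpace α]
    [SecondCountableTopology α] [MeasurableSpace α] [OpensMeasurableSpace α] :
    ∃ F : Finset ℕ × ℕ → α → ℝ,
      (∀ j, ∃ K : ℝ≥0, LipschitzWith K (F j)) ∧ (∀ j x, |F j x| ≤ 1) ∧
      ∀ (μ : Measure α) (μs : ℕ → Measure α), IsProbabilityMeasure μ →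
        (∀ n, IsProbabilityMeasure (μs n)) →
        (∀ j, Tendsto (fun n => ∫ x, F j x ∂μs n) atTop (𝓝 (∫ x, F j x ∂μ))) →
        ∀ f : BoundedContinuousFunction α ℝ,
          Tendsto (fun n => ∫ x, f x ∂μs n) atTop (𝓝 (∫ x, f x ∂μ)) := by
  obtain ⟨b, hb⟩ : ∃ b : ℕ → Set α, TopologicalSpace.IsTopologicalBasis (Set.range b) := by
    have hne : (insert ∅ (TopologicalSpace.countableBasis α)).Nonempty := ⟨∅, by simp⟩
    obtain ⟨b, hb⟩ := ((TopologicalSpace.countable_countableBasis α).insert ∅).exists_eq_range hne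
    refine ⟨b, hb ▸ ?_⟩
    exact (TopologicalSpace.isBasis_countableBasis α).insert_empty
  have hbo (i : ℕ) : IsOpen (b i) := hb.isOpen ⟨i, rfl⟩
  have hpos (j : ℕ) : (0 : ℝ) < 1 / ((j : ℝ) + 1) := Nat.one_div_pos_of_nat
  let C : Finset ℕ → Set α := fun s => (⋃ i ∈ s, b i)ᶜ
  have hUo (s : Finset ℕ) : IsOpen (⋃ i ∈ s, b i) := isOpen_biUnion fun i _ => hbo i
  have hC (s : Finset ℕ) : IsClosed (C s) := (hUo s).isClosed_compl
  refine ⟨fun p x => thickenedIndicator (hpos p.2) (C p.1) x, fun p => ?_, fun p x => ?_, ?_⟩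
  · exact ⟨_, (NNReal.isometry_coe.lipschitz.comp (lipschitzWith_thickenedIndicator (hpos p.2) _))⟩
  · simpa using thickenedIndicator_le_one (hpos p.2) (C p.1) x
  intro μ μs hμ hμs h
  have key : Tendsto (β := ProbabilityMeasure α) (fun n => ⟨μs n, hμs n⟩) atTop (𝓝 ⟨μ, hμ⟩) := by
    refine tendsto_of_forall_isOpen_le_liminf' fun G hG => ?_
    change μ G ≤ liminf (fun i => μs i G) atTop
    refine le_of_forall_lt fun c hc => ?_
    obtain ⟨d, hcd, hd⟩ := exists_between hc
    refine hcd.trans_le (le_liminf_of_le (by isBoundedDefault) ?_)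
    obtain ⟨s, hsG, hs⟩ : ∃ s : Finset ℕ, (⋃ i ∈ s, b i) ⊆ G ∧ d < μ (⋃ i ∈ s, b i) := by
      classical
      let B : ℕ → Set α := fun N => ⋃ i ∈ (Finset.range N).filter (fun i => b i ⊆ G), b i
      have hBmono : Monotone B := fun N M hNM => by
        refine Set.biUnion_subset_biUnion_left fun i hi => ?_
        have hi := Finset.mem_filter.1 hi
        refine Finset.mem_coe.2 (Finset.mem_filter.2 ⟨?_, hi.2⟩)
        exact Finset.mem_range.2 ((Finset.mem_range.1 hi.1).trans_le hNM)
      have hBG : ⋃ N, B N = G := by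
        refine Set.Subset.antisymm (Set.iUnion_subset fun N => Set.iUnion₂_subset fun i hi =>
          (Finset.mem_filter.1 hi).2) fun x hx => ?_
        obtain ⟨_, ⟨i, rfl⟩, hxi, hi⟩ := hb.exists_subset_of_mem_open hx hG
        exact Set.mem_iUnion.2 ⟨i + 1, Set.mem_iUnion₂.2 ⟨i, by simp [hi], hxi⟩⟩
      have := tendsto_measure_iUnion_atTop (μ := μ) hBmono
      rw [hBG] at this
      obtain ⟨N, hN⟩ := (this.eventually (lt_mem_nhds hd)).exists
      exact ⟨_, Set.iUnion₂_subset fun i hi => (Finset.mem_filter.1 hi).2, hN⟩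
    have hd1 : d ≠ ⊤ := ne_top_of_lt (hd.trans_le prob_le_one)
    have hμC : μ.real (C s) < 1 - d.toReal := by
      have h1 : μ.real (C s) = 1 - μ.real (⋃ i ∈ s, b i) :=
        probReal_compl_eq_one_sub (hUo s).measurableSet
      have h2 : d.toReal < μ.real (⋃ i ∈ s, b i) :=
        (ENNReal.toReal_lt_toReal hd1 (measure_ne_top _ _)).2 hs
      linarith
    obtain ⟨j, hj⟩ := ((tendsto_integral_thickenedIndicator_of_isClosed μ (hC s) hpos
      tendsto_one_div_add_atTop_nhds_zero_nat).eventually (gt_mem_nhds hμC)).exists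
    filter_upwards [(h (s, j)).eventually (gt_mem_nhds hj)] with n hn
    have h1 : (μs n).real (C s) ≤ ∫ x, (thickenedIndicator (hpos j) (C s) x : ℝ) ∂μs n := by
      rw [← integral_indicator_one (hC s).measurableSet]
      refine integral_mono ((integrable_const 1).indicator (hC s).measurableSet)
        (integrable_thickenedIndicator _ (hpos j)) fun x => ?_
      by_cases hx : x ∈ C s
      · rw [Set.indicator_of_mem hx, thickenedIndicator_one (hpos j) _ hx]; simp
      · simp [hx]
    have h2 : (μs n).real (C s) = 1 - (μs n).real (⋃ i ∈ s, b i) :=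
      probReal_compl_eq_one_sub (hUo s).measurableSet
    have h3 : d.toReal ≤ (μs n).real (⋃ i ∈ s, b i) := by
      linarith
    refine le_trans ?_ (measure_mono hsG)
    rw [← ENNReal.ofReal_toReal hd1]
    exact ENNReal.ofReal_le_of_le_toReal h3
  exact ProbabilityMeasure.tendsto_iff_forall_integral_tendsto.1 key

theorem integral_exp_stdGaussian (t : ℝ) :
    ∫ x, Complex.exp ((t * x : ℝ) * Complex.I) ∂stdGaussian
      = Complex.exp (-(t ^ 2 / 2 : ℝ)) := by
  have h := charFun_gaussianReal (μ := 0) (v := 1) t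
  rw [charFun_apply_real] at h
  simpa [stdGaussian, neg_div] using h

theorem integral_exp_gaussianPi {ι : Type*} [Fintype ι] (c : ι → ℝ) :
    ∫ x, Complex.exp ((∑ i, c i * x i : ℝ) * Complex.I) ∂gaussianPi ι
      = Complex.exp (-((∑ i, c i ^ 2) / 2 : ℝ)) := by
  have h (x : ι → ℝ) : Complex.exp ((∑ i, c i * x i : ℝ) * Complex.I)
      = ∏ i, Complex.exp ((c i * x i : ℝ) * Complex.I) := by
    rw [← Complex.exp_sum, ← Finset.sum_mul]; push_cast; rfl
  simp_rw [h, gaussianPi]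
  rw [integral_fintype_prod_eq_prod (fun i y => Complex.exp ((c i * y : ℝ) * Complex.I))]
  simp_rw [integral_exp_stdGaussian]
  rw [← Complex.exp_sum]
  congr 1
  push_cast
  rw [Finset.sum_neg_distrib, Finset.sum_div]

theorem Measure.ext_of_integral_exp {ι : Type*} [Fintype ι] {μ ν : Measure (ι → ℝ)}
    [IsFiniteMeasure μ] [IsFiniteMeasure ν]
    (h : ∀ t : ι → ℝ, ∫ x, Complex.exp ((∑ i, t i * x i : ℝ) * Complex.I) ∂μ
      = ∫ x, Complex.exp ((∑ i, t i * x i : ℝ) * Complex.I) ∂ν) : μ = ν := by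
  refine (MeasurableEquiv.toLp 2 (ι → ℝ)).map_measurableEquiv_injective
    <| Measure.ext_of_charFun <| funext fun t ↦ ?_
  have key (ρ : Measure (ι → ℝ)) : charFun (ρ.map (MeasurableEquiv.toLp 2 (ι → ℝ))) t
      = ∫ x, Complex.exp ((∑ i, t i * x i : ℝ) * Complex.I) ∂ρ := by
    rw [charFun_apply, integral_map_equiv]
    simp [PiLp.inner_apply]
  rw [key, key, h]

/-- Replacing the component of a Gaussian vector along a unit (or zero) vector `u` by a fresh
Gaussian variable preserves the standard Gaussian law. -/
theorem measurePreserving_resample {ι : Type*} [Fintype ι] (u : ι → ℝ)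
    (hu : ∑ i, u i ^ 2 = 1 ∨ u = 0) :
    MeasurePreserving (fun p : (ι → ℝ) × ℝ => fun i => p.1 i - (∑ j, p.1 j * u j) * u i + p.2 * u i)
      ((gaussianPi ι).prod stdGaussian) (gaussianPi ι) := by
  have hmeas : Measurable (fun p : (ι → ℝ) × ℝ => fun i =>
      p.1 i - (∑ j, p.1 j * u j) * u i + p.2 * u i) := by fun_prop
  refine ⟨hmeas, ?_⟩
  have := Measure.isProbabilityMeasure_map (μ := (gaussianPi ι).prod stdGaussian) hmeas.aemeasurable
  refine Measure.ext_of_integral_exp fun t => ?_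
  rw [integral_map hmeas.aemeasurable (Measurable.aestronglyMeasurable (by fun_prop)),
    integral_exp_gaussianPi]
  set s := ∑ i, t i * u i with hs
  have h (p : (ι → ℝ) × ℝ) : Complex.exp
      ((∑ i, t i * (p.1 i - (∑ j, p.1 j * u j) * u i + p.2 * u i) : ℝ) * Complex.I)
      = Complex.exp ((∑ i, (t i - s * u i) * p.1 i : ℝ) * Complex.I)
        * Complex.exp ((s * p.2 : ℝ) * Complex.I) := by
    rw [← Complex.exp_add, ← add_mul, ← Complex.ofReal_add]
    congr 3
    have h1 : ∀ i, t i * (p.1 i - (∑ j, p.1 j * u j) * u i + p.2 * u i)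
      = t i * p.1 i - (∑ j, p.1 j * u j) * (t i * u i) + p.2 * (t i * u i) := fun i => by ring
    have h2 : ∀ i, (t i - s * u i) * p.1 i = t i * p.1 i - s * (p.1 i * u i) := fun i => by ring
    simp_rw [h1, h2, Finset.sum_add_distrib, Finset.sum_sub_distrib, ← Finset.mul_sum, ← hs]
    ring
  simp_rw [h]
  rw [integral_prod_mul (fun x : ι → ℝ => Complex.exp ((∑ i, (t i - s * u i) * x i : ℝ) * Complex.I))
    (fun y : ℝ => Complex.exp ((s * y : ℝ) * Complex.I)), integral_exp_gaussianPi,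
    integral_exp_stdGaussian, ← Complex.exp_add, ← Complex.ofReal_neg, ← Complex.ofReal_neg,
    ← Complex.ofReal_neg, ← Complex.ofReal_add]
  congr 2
  have h1 : ∑ i, (t i - s * u i) ^ 2 = ∑ i, t i ^ 2 - 2 * s * s + s ^ 2 * ∑ i, u i ^ 2 := by
    have h2 : ∀ i, (t i - s * u i) ^ 2 = t i ^ 2 - 2 * s * (t i * u i) + s ^ 2 * u i ^ 2 :=
      fun i => by ring
    simp_rw [h2, Finset.sum_add_distrib, Finset.sum_sub_distrib, ← Finset.mul_sum, ← hs]
  rw [h1]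
  rcases hu with hu | hu
  · rw [hu]; ring
  · have : s = 0 := by simp [hs, hu]
    rw [this]; ring

/-- If `A` has i.i.d. standard Gaussian entries, then `Aᵀ y` has the law of `‖y‖ z`, with `z` a
standard Gaussian vector. -/
theorem map_transpose_mulVec_gaussian {ι κ : Type*} [Fintype ι] [Fintype κ] (y : κ → ℝ) :
    (Measure.pi fun _ : κ => gaussianPi ι).map (fun A i => ∑ r, A r i * y r)
      = (gaussianPi ι).map (fun z i => √(∑ r, y r ^ 2) * z i) := by
  have h1 : Measurable (fun (A : κ → ι → ℝ) i => ∑ r, A r i * y r) := by fun_prop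
  have h2 : Measurable (fun (z : ι → ℝ) i => √(∑ r, y r ^ 2) * z i) := by fun_prop
  have := Measure.isProbabilityMeasure_map (μ := Measure.pi fun _ : κ => gaussianPi ι)
    h1.aemeasurable
  have := Measure.isProbabilityMeasure_map (μ := gaussianPi ι) h2.aemeasurable
  refine Measure.ext_of_integral_exp fun t => ?_
  rw [integral_map h1.aemeasurable (Measurable.aestronglyMeasurable (by fun_prop)),
    integral_map h2.aemeasurable (Measurable.aestronglyMeasurable (by fun_prop))]
  have e1 (A : κ → ι → ℝ) : Complex.exp ((∑ i, t i * ∑ r, A r i * y r : ℝ) * Complex.I)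
      = ∏ r, Complex.exp ((∑ i, (y r * t i) * A r i : ℝ) * Complex.I) := by
    rw [← Complex.exp_sum, ← Finset.sum_mul, ← Complex.ofReal_sum]
    congr 3
    simp_rw [Finset.mul_sum]
    rw [Finset.sum_comm]
    exact Finset.sum_congr rfl fun r _ => Finset.sum_congr rfl fun i _ => by ring
  have e2 (z : ι → ℝ) : ∑ i, t i * (√(∑ r, y r ^ 2) * z i)
      = ∑ i, (√(∑ r, y r ^ 2) * t i) * z i := Finset.sum_congr rfl fun i _ => by ring
  simp_rw [e1, e2]
  rw [integral_fintype_prod_eq_prod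
    (fun r (a : ι → ℝ) => Complex.exp ((∑ i, (y r * t i) * a i : ℝ) * Complex.I))]
  simp_rw [integral_exp_gaussianPi]
  rw [← Complex.exp_sum, Finset.sum_neg_distrib, ← Complex.ofReal_sum]
  congr 3
  simp_rw [mul_pow, ← Finset.mul_sum]
  rw [Real.sq_sqrt (Finset.sum_nonneg fun _ _ => sq_nonneg _), ← Finset.sum_div, ← Finset.sum_mul]

/-- The vector `x` scaled to unit length (zero if `x = 0`). -/
def unitDir {n : ℕ} (x : Fin n → ℝ) : Fin n → ℝ := fun i => x i / √(∑ j, x j ^ 2)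

theorem unitDir_sq_sum {n : ℕ} (x : Fin n → ℝ) :
    ∑ i, unitDir x i ^ 2 = 1 ∨ unitDir x = 0 := by
  have hnn : 0 ≤ ∑ j, x j ^ 2 := Finset.sum_nonneg fun _ _ => sq_nonneg _
  rcases hnn.eq_or_lt with h | h
  · right
    ext i
    simp [unitDir, ← h]
  · left
    simp_rw [unitDir, div_pow, ← Finset.sum_div, Real.sq_sqrt hnn]
    exact div_self h.ne'

theorem sqrt_mul_unitDir {n : ℕ} (x : Fin n → ℝ) (i : Fin n) :
    √(∑ j, x j ^ 2) * unitDir x i = x i := by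
  have hnn : 0 ≤ ∑ j, x j ^ 2 := Finset.sum_nonneg fun _ _ => sq_nonneg _
  rcases hnn.eq_or_lt with h | h
  · have hx : x i ^ 2 = 0 :=
      (Finset.sum_eq_zero_iff_of_nonneg fun _ _ => sq_nonneg _).1 h.symm i (Finset.mem_univ i)
    simp [← h, pow_eq_zero_iff (two_ne_zero) |>.1 hx]
  · rw [unitDir, mul_div_cancel₀ _ (Real.sqrt_pos.2 h).ne']

theorem sum_unitDir_mul {n : ℕ} (x : Fin n → ℝ) :
    ∑ i, unitDir x i * x i = √(∑ j, x j ^ 2) := by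
  have h : ∀ i, unitDir x i * x i = x i ^ 2 / √(∑ j, x j ^ 2) := fun i => by
    rw [unitDir]; ring
  simp_rw [h, ← Finset.sum_div]
  exact Real.div_sqrt

/-- The observation for signal `x` and noise `w`, when `g` stands for `A x / ‖x‖`. -/
def obsOf {n m : ℕ} (s : ℝ) (x : Fin n → ℝ) (w g : Fin m → ℝ) : Fin m → ℝ :=
  fun r => s * (√(∑ i, x i ^ 2) * g r) + w r

/-- The vector `v`, with its component along `x` replaced by `⟨g, y⟩`. -/
def replaceDir {n m : ℕ} (x : Fin n → ℝ) (g y : Fin m → ℝ) (v : Fin n → ℝ) : Fin n → ℝ :=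
  fun i => v i - (∑ j, v j * unitDir x j) * unitDir x i + (∑ r, g r * y r) * unitDir x i

theorem measurePreserving_resample_rows {n m : ℕ} (x : Fin n → ℝ) :
    MeasurePreserving (fun p : (Fin m → Fin n → ℝ) × (Fin m → ℝ) => fun r i =>
        p.1 r i - (∑ j, p.1 r j * unitDir x j) * unitDir x i + p.2 r * unitDir x i)
      ((Measure.pi fun _ : Fin m => gaussianPi (Fin n)).prod (gaussianPi (Fin m)))
      (Measure.pi fun _ : Fin m => gaussianPi (Fin n)) := by
  have h1 := (measurePreserving_arrowProdEquivProdArrow (Fin n → ℝ) ℝ (Fin m)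
    (fun _ => gaussianPi (Fin n)) (fun _ => stdGaussian)).symm
  have h2 := measurePreserving_pi (fun _ : Fin m => (gaussianPi (Fin n)).prod stdGaussian)
    (fun _ : Fin m => gaussianPi (Fin n))
    (fun _ => measurePreserving_resample (unitDir x) (unitDir_sq_sum x))
  exact h2.comp h1

/-- Law of `Aᵀ y` for `y = s A x + w`, at fixed `x` and `w`. -/
theorem map_transpose_obs {n m : ℕ} (s : ℝ) (x : Fin n → ℝ) (w : Fin m → ℝ) :
    (Measure.pi fun _ : Fin m => gaussianPi (Fin n)).map
        (fun A i => ∑ r, A r i * (s * (∑ j, A r j * x j) + w r))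
      = ((gaussianPi (Fin n)).prod (gaussianPi (Fin m))).map (fun p =>
          replaceDir x p.2 (obsOf s x w p.2) (fun i => √(∑ r, obsOf s x w p.2 r ^ 2) * p.1 i)) := by
  have hm1 : Measurable (fun (A : Fin m → Fin n → ℝ) i =>
      ∑ r, A r i * (s * (∑ j, A r j * x j) + w r)) := by fun_prop
  have hm2 : Measurable (fun p : (Fin n → ℝ) × (Fin m → ℝ) =>
      replaceDir x p.2 (obsOf s x w p.2) (fun i => √(∑ r, obsOf s x w p.2 r ^ 2) * p.1 i)) := by
    unfold replaceDir obsOf; fun_prop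
  have hm3 : Measurable (fun p : (Fin m → Fin n → ℝ) × (Fin m → ℝ) =>
      replaceDir x p.2 (obsOf s x w p.2) (fun i => ∑ r, p.1 r i * obsOf s x w p.2 r)) := by
    unfold replaceDir obsOf; fun_prop
  have hT := measurePreserving_resample_rows (m := m) x
  have hcomp : (fun p : (Fin m → Fin n → ℝ) × (Fin m → ℝ) =>
      replaceDir x p.2 (obsOf s x w p.2) (fun i => ∑ r, p.1 r i * obsOf s x w p.2 r))
      = (fun (A : Fin m → Fin n → ℝ) i => ∑ r, A r i * (s * (∑ j, A r j * x j) + w r)) ∘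
        (fun p : (Fin m → Fin n → ℝ) × (Fin m → ℝ) => fun r i =>
        p.1 r i - (∑ j, p.1 r j * unitDir x j) * unitDir x i + p.2 r * unitDir x i) := by
    funext p i
    have hAx (r : Fin m) : ∑ i, (p.1 r i - (∑ j, p.1 r j * unitDir x j) * unitDir x i
        + p.2 r * unitDir x i) * x i = √(∑ i, x i ^ 2) * p.2 r := by
      have e1 : ∀ i, (p.1 r i - (∑ j, p.1 r j * unitDir x j) * unitDir x i
        + p.2 r * unitDir x i) * x i = p.1 r i * x i
          - (∑ j, p.1 r j * unitDir x j) * (unitDir x i * x i) + p.2 r * (unitDir x i * x i) :=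
        fun i => by ring
      have e2 : (∑ j, p.1 r j * unitDir x j) * √(∑ i, x i ^ 2) = ∑ i, p.1 r i * x i := by
        rw [Finset.sum_mul]
        refine Finset.sum_congr rfl fun i _ => ?_
        rw [mul_assoc, mul_comm (unitDir x i), sqrt_mul_unitDir]
      simp_rw [e1, Finset.sum_add_distrib, Finset.sum_sub_distrib, ← Finset.mul_sum,
        sum_unitDir_mul, e2]
      ring
    simp only [Function.comp_apply, hAx, replaceDir]
    change _ = ∑ r, (p.1 r i - (∑ j, p.1 r j * unitDir x j) * unitDir x i
        + p.2 r * unitDir x i) * obsOf s x w p.2 r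
    have e3 : ∀ r, (p.1 r i - (∑ j, p.1 r j * unitDir x j) * unitDir x i
        + p.2 r * unitDir x i) * obsOf s x w p.2 r = p.1 r i * obsOf s x w p.2 r
        - (∑ j, (p.1 r j * obsOf s x w p.2 r) * unitDir x j) * unitDir x i
        + (p.2 r * obsOf s x w p.2 r) * unitDir x i := fun r => by
      have : ∑ j, (p.1 r j * obsOf s x w p.2 r) * unitDir x j
          = (∑ j, p.1 r j * unitDir x j) * obsOf s x w p.2 r := by
        rw [Finset.sum_mul]; exact Finset.sum_congr rfl fun _ _ => by ring
      rw [this]; ring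
    simp_rw [e3, Finset.sum_add_distrib, Finset.sum_sub_distrib, ← Finset.sum_mul]
    congr 3
    rw [Finset.sum_comm]
    simp_rw [Finset.sum_mul]
  refine Measure.ext fun B hB => ?_
  rw [← hT.map_eq, Measure.map_map hm1 hT.measurable, ← hcomp, Measure.map_apply hm3 hB,
    Measure.map_apply hm2 hB, Measure.prod_apply_symm (hm3 hB), Measure.prod_apply_symm (hm2 hB)]
  refine lintegral_congr fun g => ?_
  have hr : Measurable (replaceDir x g (obsOf s x w g)) := by
    unfold replaceDir obsOf; fun_prop
  have key := congrArg (fun μ => μ (replaceDir x g (obsOf s x w g) ⁻¹' B))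
    (map_transpose_mulVec_gaussian (ι := Fin n) (obsOf s x w g))
  rw [Measure.map_apply (by fun_prop) (hr hB), Measure.map_apply (by fun_prop) (hr hB)] at key
  exact key

/-- Sample space carrying `(S, (x, w), (z, g))`. -/
abbrev RotSpace (n m : ℕ) : Type :=
  Finset (Fin n) × ((Fin n → ℝ) × (Fin m → ℝ)) × ((Fin n → ℝ) × (Fin m → ℝ))

/-- The law on `RotSpace`: uniform pattern and independent standard Gaussian vectors. -/
def rotLaw (n m k : ℕ) : Measure (RotSpace n m) :=
  (uniformPatterns n k).prod (((gaussianPi (Fin n)).prod (gaussianPi (Fin m))).prod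
    ((gaussianPi (Fin n)).prod (gaussianPi (Fin m))))

/-- The sparse vector as a function on `RotSpace`. -/
def rotX (n m : ℕ) (ω : RotSpace n m) : Fin n → ℝ := signal n ω.1 ω.2.1.1

/-- The observation as a function on `RotSpace`. -/
def rotY (n m : ℕ) (SNR : ℝ) (k : ℕ) (ω : RotSpace n m) : Fin m → ℝ :=
  obsOf √(SNR / k) (rotX n m ω) ω.2.1.2 ω.2.2.2

/-- A vector on `RotSpace` with the joint law of the matched filter estimate. -/
def rotEst (n m : ℕ) (SNR : ℝ) (k : ℕ) (ω : RotSpace n m) : Fin n → ℝ :=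
  fun i => (1 / m) * √(k / SNR) * replaceDir (rotX n m ω) ω.2.2.2 (rotY n m SNR k ω)
    (fun i => √(∑ r, rotY n m SNR k ω r ^ 2) * ω.2.2.1 i) i

instance (n : ℕ) : DiscreteMeasurableSpace (Finset (Fin n)) := ⟨fun _ => trivial⟩

theorem measurable_signal {n : ℕ} (S : Finset (Fin n)) : Measurable (signal n S) := by
  unfold signal
  refine measurable_pi_lambda _ fun i => ?_
  split_ifs
  · fun_prop
  · fun_prop

theorem measurable_mf_pair (n m : ℕ) (SNR : ℝ) (k : ℕ) :
    Measurable (fun ω : MFSpace n m => (Xvec n m ω, mfEst n m SNR k ω)) := by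
  refine measurable_from_prod_countable_right fun S => ?_
  have := measurable_signal S
  unfold mfEst Yvec Xvec
  dsimp only
  fun_prop

theorem measurable_rot_pair (n m : ℕ) (SNR : ℝ) (k : ℕ) :
    Measurable (fun ω : RotSpace n m => (rotX n m ω, rotEst n m SNR k ω)) := by
  refine measurable_from_prod_countable_right fun S => ?_
  have := measurable_signal S
  unfold rotEst rotY replaceDir obsOf unitDir rotX
  dsimp only
  fun_prop

/-- The signal and its matched filter estimate have the same joint law in both models. -/
theorem map_mfLaw_eq_map_rotLaw (n m : ℕ) (SNR : ℝ) (k : ℕ) :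
    (mfLaw n m k).map (fun ω => (Xvec n m ω, mfEst n m SNR k ω))
      = (rotLaw n m k).map (fun ω => (rotX n m ω, rotEst n m SNR k ω)) := by
  refine Measure.ext fun B hB => ?_
  have h1 := measurable_mf_pair n m SNR k
  have h2 := measurable_rot_pair n m SNR k
  rw [Measure.map_apply h1 hB, Measure.map_apply h2 hB, mfLaw, rotLaw,
    Measure.prod_apply (h1 hB), Measure.prod_apply (h2 hB)]
  refine lintegral_congr fun S => ?_
  have hre : MeasurePreserving
      (fun q : ((Fin n → ℝ) × (Fin m → ℝ)) × (Fin m → Fin n → ℝ) => (q.1.1, q.2, q.1.2))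
      (((gaussianPi (Fin n)).prod (gaussianPi (Fin m))).prod
        (Measure.pi fun _ : Fin m => gaussianPi (Fin n)))
      ((gaussianPi (Fin n)).prod ((Measure.pi fun _ : Fin m => gaussianPi (Fin n)).prod
        (gaussianPi (Fin m)))) :=
    ((MeasurePreserving.id _).prod Measure.measurePreserving_swap).comp
      (measurePreserving_prodAssoc _ _ _)
  have hB1 := (h1.comp (measurable_prodMk_left (x := S))) hB
  have hB2 := (h2.comp (measurable_prodMk_left (x := S))) hB
  have e1 := hre.measure_preimage hB1.nullMeasurableSet
  refine e1.symm.trans ?_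
  rw [Measure.prod_apply (hre.measurable hB1)]
  refine Eq.trans ?_ (Measure.prod_apply hB2).symm
  refine lintegral_congr fun ⟨x, w⟩ => ?_
  have hsc : Measurable (fun v : Fin n → ℝ =>
      (signal n S x, fun i => (1 / (m : ℝ)) * √(k / SNR) * v i)) := by
    fun_prop
  have key := congrArg (fun μ => μ ((fun v : Fin n → ℝ =>
      (signal n S x, fun i => (1 / (m : ℝ)) * √(k / SNR) * v i)) ⁻¹' B))
    (map_transpose_obs √(SNR / k) (signal n S x) w)
  rw [Measure.map_apply (by fun_prop) (hsc hB), Measure.map_apply ?_ (hsc hB)] at key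
  · exact key
  · unfold replaceDir obsOf; fun_prop


theorem integrable_pow_of_memLp_four {Ω : Type*} [MeasurableSpace Ω] {μ : Measure Ω}
    [IsProbabilityMeasure μ] {X : Ω → ℝ} (hX : MemLp X 4 μ) {j : ℕ} (hj : j ≤ 4) :
    Integrable (fun ω => X ω ^ j) μ := by
  have h1 : MemLp X (j : ℝ≥0∞) μ := hX.mono_exponent (by exact_mod_cast hj)
  refine (integrable_norm_iff (hX.1.pow j)).1 ?_
  simpa [norm_pow] using h1.integrable_norm_pow'

theorem integral_add_pow_of_indepFun {Ω : Type*} [MeasurableSpace Ω] {μ : Measure Ω}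
    [IsProbabilityMeasure μ] {X Y : Ω → ℝ} (h : IndepFun X Y μ) (hX : MemLp X 4 μ)
    (hY : MemLp Y 4 μ) {N : ℕ} (hN : N ≤ 4) :
    ∫ ω, (X ω + Y ω) ^ N ∂μ = ∑ a ∈ Finset.range (N + 1),
      (∫ ω, X ω ^ a ∂μ) * (∫ ω, Y ω ^ (N - a) ∂μ) * (N.choose a : ℝ) := by
  have hi (a b : ℕ) : IndepFun (fun ω => X ω ^ a) (fun ω => Y ω ^ b) μ :=
    h.comp (measurable_id.pow_const a) (measurable_id.pow_const b)
  have pX {a : ℕ} (ha : a ≤ 4) := integrable_pow_of_memLp_four hX ha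
  have pY {a : ℕ} (ha : a ≤ 4) := integrable_pow_of_memLp_four hY ha
  simp_rw [add_pow]
  have hle {a : ℕ} (ha : a ∈ Finset.range (N + 1)) : a ≤ 4 := by
    rw [Finset.mem_range] at ha; omega
  rw [integral_finsetSum]
  · refine Finset.sum_congr rfl fun a ha => ?_
    rw [integral_mul_const, (hi a (N - a)).integral_fun_mul_eq_mul_integral (pX (hle ha)).1
      (pY ((Nat.sub_le _ _).trans hN)).1]
  · exact fun a ha => ((hi a (N - a)).integrable_mul (pX (hle ha))
      (pY ((Nat.sub_le _ _).trans hN))).mul_const _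

theorem moments_sum_of_iIndepFun {Ω ι : Type*} [MeasurableSpace Ω] {μ : Measure Ω}
    [IsProbabilityMeasure μ] {X : ι → Ω → ℝ} (hind : iIndepFun X μ)
    (hmeas : ∀ i, Measurable (X i)) (hX : ∀ i, MemLp (X i) 4 μ)
    (hX1 : ∀ i, ∫ ω, X i ω ∂μ = 0) {C : ℝ} (hX2 : ∀ i, ∫ ω, X i ω ^ 2 ∂μ ≤ C)
    (hX4 : ∀ i, ∫ ω, X i ω ^ 4 ∂μ ≤ 3 * C ^ 2) (s : Finset ι) :
    MemLp (∑ i ∈ s, X i) 4 μ ∧ ∫ ω, (∑ i ∈ s, X i) ω ∂μ = 0 ∧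
      ∫ ω, (∑ i ∈ s, X i) ω ^ 2 ∂μ ≤ C * s.card ∧
      ∫ ω, (∑ i ∈ s, X i) ω ^ 4 ∂μ ≤ 3 * C ^ 2 * s.card ^ 2 := by
  classical
  induction s using Finset.induction_on with
  | empty => simp
  | insert i s hi ih =>
    obtain ⟨h0, h1, h2, h4⟩ := ih
    have hindep : IndepFun (∑ j ∈ s, X j) (X i) μ :=
      hind.indepFun_finsetSum_of_notMem hmeas hi
    have hadd {N : ℕ} (hN : N ≤ 4) := integral_add_pow_of_indepFun hindep h0 (hX i) hN
    have hC : 0 ≤ C := (integral_nonneg fun ω => sq_nonneg _).trans (hX2 i)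
    rw [Finset.sum_insert hi, Finset.card_insert_of_notMem hi, add_comm (X i)]
    simp only [Pi.add_apply]
    refine ⟨h0.add (hX i), ?_, ?_, ?_⟩
    · rw [integral_add (h0.integrable (by norm_num)) ((hX i).integrable (by norm_num)), h1, hX1,
        add_zero]
    · rw [hadd (by norm_num)]
      simp only [Finset.sum_range_succ, Finset.sum_range_zero, pow_zero, pow_one, h1]
      norm_num [-Finset.sum_apply, hX1 i]
      linarith [hX2 i]
    · rw [hadd le_rfl]
      simp only [Finset.sum_range_succ, Finset.sum_range_zero, pow_zero, pow_one, h1]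
      have hch : Nat.choose 4 2 = 6 := rfl
      norm_num [hch, hX1 i, -Finset.sum_apply]
      have := mul_le_mul h2 (hX2 i) (integral_nonneg fun ω => sq_nonneg _) (by positivity)
      linarith [hX4 i]

/-- Fourth moment tail bound for a sum of independent centered variables. -/
theorem pi_tail {ι α : Type*} [Fintype ι] [MeasurableSpace α] (μ : Measure α)
    [IsProbabilityMeasure μ] {φ : ι → α → ℝ} (hmeas : ∀ i, Measurable (φ i))
    (h4 : ∀ i, MemLp (φ i) 4 μ) (h1 : ∀ i, ∫ x, φ i x ∂μ = 0) {C : ℝ}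
    (hC2 : ∀ i, ∫ x, φ i x ^ 2 ∂μ ≤ C) (hC4 : ∀ i, ∫ x, φ i x ^ 4 ∂μ ≤ 3 * C ^ 2)
    {ε : ℝ} (hε : 0 < ε) :
    (Measure.pi fun _ : ι => μ) {x | ε ≤ |∑ i, φ i (x i)|}
      ≤ ENNReal.ofReal (3 * C ^ 2 * (Fintype.card ι : ℝ) ^ 2 / ε ^ 4) := by
  have hmp (i : ι) : MeasurePreserving (fun x : ι → α => x i) (Measure.pi fun _ : ι => μ) μ :=
    measurePreserving_eval (fun _ : ι => μ) i
  have hind : iIndepFun (fun i (x : ι → α) => φ i (x i)) (Measure.pi fun _ : ι => μ) :=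
    iIndepFun_pi fun i => (hmeas i).aemeasurable
  have hint (i : ι) {f : α → ℝ} (hf : Measurable f) :
      ∫ x, f (x i) ∂(Measure.pi fun _ : ι => μ) = ∫ x, f x ∂μ := by
    conv_rhs => rw [← (hmp i).map_eq]
    rw [integral_map (hmp i).measurable.aemeasurable hf.aestronglyMeasurable]
  obtain ⟨m0, -, -, m4⟩ := moments_sum_of_iIndepFun hind
    (fun i => (hmeas i).comp (measurable_pi_apply i))
    (fun i => (h4 i).comp_measurePreserving (hmp i))
    (fun i => (hint i (hmeas i)).trans (h1 i))
    (fun i => (hint i ((hmeas i).pow_const 2)).trans_le (hC2 i))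
    (fun i => (hint i ((hmeas i).pow_const 4)).trans_le (hC4 i)) Finset.univ
  have hmk := mul_meas_ge_le_integral_of_nonneg
    (ae_of_all _ fun x => by positivity) (integrable_pow_of_memLp_four m0 le_rfl) (ε ^ 4)
  have hset : {x : ι → α | ε ≤ |∑ i, φ i (x i)|} ⊆
      {x | ε ^ 4 ≤ (∑ i, fun x : ι → α => φ i (x i)) x ^ 4} := fun x hx => by
    simp only [Set.mem_ofPred_eq, Finset.sum_apply] at hx ⊢
    rw [← (show Even 4 by decide).pow_abs (∑ i, φ i (x i))]
    gcongr
  have hr : (Measure.pi fun _ : ι => μ).real {x | ε ≤ |∑ i, φ i (x i)|}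
      ≤ 3 * C ^ 2 * (Fintype.card ι : ℝ) ^ 2 / ε ^ 4 := by
    rw [le_div_iff₀' (by positivity)]
    refine (mul_le_mul_of_nonneg_left (measureReal_mono hset) (by positivity)).trans
      (hmk.trans (m4.trans_eq ?_))
    rw [Finset.card_univ]
  rw [← ofReal_measureReal]
  exact ENNReal.ofReal_le_ofReal hr

/-- The filter of sets whose complements have summable measure along the family `μ`. -/
def tailFilter {E : ℕ → Type*} [∀ n, MeasurableSpace (E n)] (μ : ∀ n, Measure (E n)) :
    Filter (Σ n, E n) where
  sets := {U | ∑' n, μ n {e | ⟨n, e⟩ ∉ U} ≠ ∞}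
  univ_sets := by simp
  sets_of_superset {U V} hU hUV := by
    have h : ∀ n, μ n {e | ⟨n, e⟩ ∉ V} ≤ μ n {e | ⟨n, e⟩ ∉ U} :=
      fun n => measure_mono fun e he hU => he (hUV hU)
    exact ((ENNReal.tsum_le_tsum h).trans_lt (lt_top_iff_ne_top.2 hU)).ne
  inter_sets {U V} hU hV := by
    have h : ∀ n, μ n {e | ⟨n, e⟩ ∉ U ∩ V} ≤ μ n {e | ⟨n, e⟩ ∉ U} + μ n {e | ⟨n, e⟩ ∉ V} :=
      fun n => (measure_mono fun e he => not_and_or.1 he).trans (measure_union_le _ _)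
    refine ((ENNReal.tsum_le_tsum h).trans_lt ?_).ne
    rw [ENNReal.tsum_add]
    exact ENNReal.add_lt_top.2 ⟨lt_top_iff_ne_top.2 hU, lt_top_iff_ne_top.2 hV⟩

section tailFilter

variable {E : ℕ → Type*} [∀ n, MeasurableSpace (E n)] {μ : ∀ n, Measure (E n)}

theorem mem_tailFilter {U : Set (Σ n, E n)} :
    U ∈ tailFilter μ ↔ ∑' n, μ n {e | ⟨n, e⟩ ∉ U} ≠ ∞ := Iff.rfl

theorem mem_tailFilter_of_eventually_le [∀ n, IsFiniteMeasure (μ n)] {U : Set (Σ n, E n)}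
    {a : ℕ → ℝ≥0∞} (ha : ∑' n, a n ≠ ∞) (h : ∀ᶠ n in atTop, μ n {e | ⟨n, e⟩ ∉ U} ≤ a n) :
    U ∈ tailFilter μ := by
  obtain ⟨N, hN⟩ := eventually_atTop.1 h
  have hle : ∀ n, μ n {e | ⟨n, e⟩ ∉ U} ≤ a n + if n < N then μ n Set.univ else 0 := fun n => by
    split_ifs with hn
    · exact (measure_mono (Set.subset_univ _)).trans le_add_self
    · simpa using hN n (not_lt.1 hn)
  refine ((ENNReal.tsum_le_tsum hle).trans_lt ?_).ne
  rw [ENNReal.tsum_add, tsum_eq_sum (f := fun n => if n < N then μ n Set.univ else 0)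
    (s := Finset.range N) (by simp +contextual)]
  refine ENNReal.add_lt_top.2 ⟨lt_top_iff_ne_top.2 ha, ENNReal.sum_lt_top.2 fun n _ => ?_⟩
  split_ifs
  · exact measure_lt_top _ _
  · exact ENNReal.zero_lt_top

theorem tendsto_fst_tailFilter [∀ n, IsFiniteMeasure (μ n)] :
    Tendsto (Sigma.fst : (Σ n, E n) → ℕ) (tailFilter μ) atTop := by
  refine tendsto_atTop.2 fun N => mem_tailFilter_of_eventually_le (a := 0) (by simp) ?_
  filter_upwards [eventually_ge_atTop N] with n hn
  simp [hn]

theorem tendsto_div_of_tail [∀ n, IsFiniteMeasure (μ n)] {T : (Σ n, E n) → ℝ} {D : ℝ}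
    (h : ∀ ε > 0, ∀ᶠ n : ℕ in atTop,
      μ n {e | ε * n ≤ |T ⟨n, e⟩|} ≤ ENNReal.ofReal (D * n ^ 2 / (ε * n) ^ 4)) :
    Tendsto (fun p => T p / p.1) (tailFilter μ) (𝓝 0) := by
  refine Metric.tendsto_nhds.2 fun ε hε => ?_
  have hs : Summable fun n : ℕ => D / ε ^ 4 * (1 / (n : ℝ) ^ 2) :=
    (Real.summable_one_div_nat_pow.2 one_lt_two).mul_left _
  refine mem_tailFilter_of_eventually_le hs.tsum_ofReal_ne_top ?_
  filter_upwards [h ε hε, eventually_gt_atTop 0] with n hn h0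
  have hn0 : (0 : ℝ) < n := by exact_mod_cast h0
  refine (measure_mono fun e he => ?_).trans (hn.trans_eq ?_)
  · simpa [Real.dist_eq, abs_div, not_lt, le_div_iff₀ hn0] using he
  · congr 1
    field_simp

theorem ae_eventually_mem_of_mem_tailFilter {Ω : Type*} [MeasurableSpace Ω] {P : Measure Ω}
    {Rv : ∀ n, Ω → E n} (hRv : ∀ᶠ n in atTop, AEMeasurable (Rv n) P ∧ P.map (Rv n) = μ n)
    {U : Set (Σ n, E n)} (hU : U ∈ tailFilter μ) :
    ∀ᵐ ω ∂P, ∀ᶠ n in atTop, (⟨n, Rv n ω⟩ : Σ n, E n) ∈ U := by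
  obtain ⟨N, hN⟩ := eventually_atTop.1 hRv
  have hle : ∀ n, P {ω | N ≤ n ∧ (⟨n, Rv n ω⟩ : Σ n, E n) ∉ U} ≤ μ n {e | ⟨n, e⟩ ∉ U} := by
    intro n
    by_cases hn : N ≤ n
    · rw [← (hN n hn).2]
      exact (measure_mono fun ω hω => hω.2).trans (Measure.le_map_apply (hN n hn).1 _)
    · simp [hn]
  have hsum := ((ENNReal.tsum_le_tsum hle).trans_lt (lt_top_iff_ne_top.2 hU)).ne
  filter_upwards [ae_eventually_notMem hsum] with ω hω
  filter_upwards [hω, eventually_ge_atTop N] with n h1 h2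
  by_contra h3
  exact h1 ⟨h2, h3⟩

theorem ae_tendsto_of_tendsto_tailFilter {Ω : Type*} [MeasurableSpace Ω] {P : Measure Ω}
    {Rv : ∀ n, Ω → E n} (hRv : ∀ᶠ n in atTop, AEMeasurable (Rv n) P ∧ P.map (Rv n) = μ n)
    {T : (Σ n, E n) → ℝ} {c : ℝ} (hT : Tendsto T (tailFilter μ) (𝓝 c)) :
    ∀ᵐ ω ∂P, Tendsto (fun n => T ⟨n, Rv n ω⟩) atTop (𝓝 c) := by
  obtain ⟨u, hu⟩ := (𝓝 c).exists_antitone_basis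
  filter_upwards [ae_all_iff.2 fun j =>
    ae_eventually_mem_of_mem_tailFilter hRv (hT (hu.1.mem_of_mem (i := j) trivial))] with ω hω
  exact hu.1.tendsto_right_iff.2 fun j _ => hω j

theorem tendsto_tailFilter_of_map_eq {E' : ℕ → Type*} [∀ n, MeasurableSpace (E' n)]
    {μ' : ∀ n, Measure (E' n)} {T : (Σ n, E n) → ℝ} {T' : (Σ n, E' n) → ℝ}
    (hT : ∀ n, Measurable fun e => T ⟨n, e⟩) (hT' : ∀ n, Measurable fun e => T' ⟨n, e⟩)
    (h : ∀ n, (μ n).map (fun e => T ⟨n, e⟩) = (μ' n).map (fun e => T' ⟨n, e⟩)) {c : ℝ}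
    (hlim : Tendsto T' (tailFilter μ') (𝓝 c)) : Tendsto T (tailFilter μ) (𝓝 c) := by
  refine Metric.tendsto_nhds.2 fun ε hε => ?_
  have h1 := Metric.tendsto_nhds.1 hlim ε hε
  rw [Filter.Eventually, mem_tailFilter] at h1 ⊢
  convert h1 using 4 with n
  have hms : MeasurableSet {y : ℝ | ¬ dist y c < ε} := by measurability
  have h2 := congrArg (fun ν => ν {y : ℝ | ¬ dist y c < ε}) (h n)
  rw [Measure.map_apply (hT n) hms, Measure.map_apply (hT' n) hms] at h2
  exact h2

end tailFilter

theorem uniformPatterns_prod_le {α : Type*} [MeasurableSpace α] {ν : Measure α} [SFinite ν]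
    {n k : ℕ} {B : Set (Finset (Fin n) × α)} (hB : MeasurableSet B) {b : ℝ≥0∞}
    (h : ∀ S ∈ patterns n k, ν {q | (S, q) ∈ B} ≤ b) : (uniformPatterns n k).prod ν B ≤ b := by
  rw [Measure.prod_apply hB, uniformPatterns, lintegral_smul_measure,
    lintegral_finsetSum_measure]
  simp_rw [lintegral_dirac]
  refine (mul_le_mul_right (Finset.sum_le_card_nsmul _ _ b h) _).trans ?_
  rw [nsmul_eq_mul, ← mul_assoc]
  exact (mul_le_mul_left (ENNReal.inv_mul_le_one _) b).trans_eq (one_mul b)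

instance (n k : ℕ) : IsFiniteMeasure (uniformPatterns n k) := by
  refine ⟨lt_of_le_of_lt (b := 1) ?_ ENNReal.one_lt_top⟩
  have h := uniformPatterns_prod_le (ν := Measure.dirac ()) (n := n) (k := k)
    (b := 1) MeasurableSet.univ fun S _ => by simp
  rw [← Set.univ_prod_univ, Measure.prod_prod] at h
  simpa using h

instance (n m k : ℕ) : IsFiniteMeasure (rotLaw n m k) := by unfold rotLaw; infer_instance

theorem measurePreserving_pairs_left (n m : ℕ) :
    MeasurePreserving (fun (q : ((Fin n → ℝ) × (Fin m → ℝ)) × ((Fin n → ℝ) × (Fin m → ℝ))) i =>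
        (q.1.1 i, q.2.1 i))
      (((gaussianPi (Fin n)).prod (gaussianPi (Fin m))).prod
        ((gaussianPi (Fin n)).prod (gaussianPi (Fin m))))
      (Measure.pi fun _ : Fin n => stdGaussian.prod stdGaussian) :=
  (measurePreserving_arrowProdEquivProdArrow ℝ ℝ (Fin n)
    (fun _ => stdGaussian) (fun _ => stdGaussian)).symm.comp
    (measurePreserving_fst.prod measurePreserving_fst)

theorem measurePreserving_pairs_right (n m : ℕ) :
    MeasurePreserving (fun (q : ((Fin n → ℝ) × (Fin m → ℝ)) × ((Fin n → ℝ) × (Fin m → ℝ))) i =>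
        (q.1.2 i, q.2.2 i))
      (((gaussianPi (Fin n)).prod (gaussianPi (Fin m))).prod
        ((gaussianPi (Fin n)).prod (gaussianPi (Fin m))))
      (Measure.pi fun _ : Fin m => stdGaussian.prod stdGaussian) :=
  (measurePreserving_arrowProdEquivProdArrow ℝ ℝ (Fin m)
    (fun _ => stdGaussian) (fun _ => stdGaussian)).symm.comp
    (measurePreserving_snd.prod measurePreserving_snd)

section LawOfLargeNumbers

variable {k m : ℕ → ℕ} {κ r : ℝ}

/-- Law of large numbers for the pairs `(X i, z i)`. -/
theorem tendsto_signal_average (hk : Tendsto (fun n => (k n : ℝ) / n) atTop (𝓝 κ))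
    {ψ : ℝ × ℝ → ℝ} (hψm : Measurable ψ) (hψ : MemLp ψ 4 (stdGaussian.prod stdGaussian))
    (hψ0 : MemLp (fun p : ℝ × ℝ => ψ (0, p.2)) 4 (stdGaussian.prod stdGaussian)) :
    Tendsto (fun p : Σ n, RotSpace n (m n) =>
        (∑ i, ψ (rotX p.1 (m p.1) p.2 i, p.2.2.2.1 i)) / p.1)
      (tailFilter fun n => rotLaw n (m n) (k n))
      (𝓝 (κ * ∫ p, ψ p ∂(stdGaussian.prod stdGaussian)
        + (1 - κ) * ∫ p, ψ (0, p.2) ∂(stdGaussian.prod stdGaussian))) := by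
  set γ := stdGaussian.prod stdGaussian
  set a := ∫ p, ψ p ∂γ
  set b := ∫ p, ψ (0, p.2) ∂γ
  have hψ0m : Measurable fun p : ℝ × ℝ => ψ (0, p.2) := by fun_prop
  have hA : MemLp (fun p => ψ p - a) 4 γ := hψ.sub (memLp_const a)
  have hB : MemLp (fun p : ℝ × ℝ => ψ (0, p.2) - b) 4 γ := hψ0.sub (memLp_const b)
  have hA1 : ∫ p, (ψ p - a) ∂γ = 0 := by
    rw [integral_sub (hψ.integrable (by norm_num)) (integrable_const a)]; simp [a]
  have hB1 : ∫ p : ℝ × ℝ, (ψ (0, p.2) - b) ∂γ = 0 := by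
    rw [integral_sub (hψ0.integrable (by norm_num)) (integrable_const b)]; simp [b]
  set A2 := ∫ p, (ψ p - a) ^ 2 ∂γ with hA2
  set A4 := ∫ p, (ψ p - a) ^ 4 ∂γ with hA4
  set B2 := ∫ p : ℝ × ℝ, (ψ (0, p.2) - b) ^ 2 ∂γ with hB2
  set B4 := ∫ p : ℝ × ℝ, (ψ (0, p.2) - b) ^ 4 ∂γ with hB4
  have hA2' : 0 ≤ A2 := integral_nonneg fun _ => by positivity
  have hA4' : 0 ≤ A4 := integral_nonneg fun _ => by positivity
  have hB2' : 0 ≤ B2 := integral_nonneg fun _ => by positivity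
  have hB4' : 0 ≤ B4 := integral_nonneg fun _ => by positivity
  obtain ⟨C, hC⟩ : ∃ C, C = 1 + A2 + A4 + B2 + B4 := ⟨_, rfl⟩
  have hC3 : C ≤ 3 * C ^ 2 := by nlinarith
  have key : Tendsto (fun p : Σ n, RotSpace n (m n) =>
      (∑ i, ψ (rotX p.1 (m p.1) p.2 i, p.2.2.2.1 i) - (k p.1 * a + (p.1 - k p.1) * b)) / p.1)
      (tailFilter fun n => rotLaw n (m n) (k n)) (𝓝 0) := by
    refine tendsto_div_of_tail (D := 3 * C ^ 2) (fun ε hε => ?_)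
    filter_upwards [eventually_gt_atTop 0] with n hn
    have hn0 : (0 : ℝ) < n := by exact_mod_cast hn
    refine uniformPatterns_prod_le ?_ fun S hS => ?_
    · refine measurableSet_le measurable_const (Measurable.abs ?_)
      refine Measurable.sub_const ?_ _
      refine measurable_from_prod_countable_right fun S => ?_
      have := measurable_signal S
      change Measurable fun q : ((Fin n → ℝ) × (Fin (m n) → ℝ)) × ((Fin n → ℝ) × (Fin (m n) → ℝ)) =>
        ∑ i, ψ (signal n S q.1.1 i, q.2.1 i)
      exact Finset.measurable_fun_sum Finset.univ fun i _ => by fun_prop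
    · have hcard : S.card = k n := (Finset.mem_powersetCard.1 hS).2
      set φ : Fin n → ℝ × ℝ → ℝ := fun i p => if i ∈ S then ψ p - a else ψ (0, p.2) - b with hφ
      have hφm (i : Fin n) : Measurable (φ i) := by
        simp only [hφ]; split_ifs <;> fun_prop
      have hsum (x z : Fin n → ℝ) : ∑ i, φ i (x i, z i)
          = ∑ i, ψ (signal n S x i, z i) - (k n * a + (n - k n) * b) := by
        have e : ∀ i, φ i (x i, z i) = ψ (signal n S x i, z i) - b
            - (if i ∈ S then a - b else 0) := fun i => by
          simp only [hφ, signal]; split_ifs <;> ring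
        simp_rw [e, Finset.sum_sub_distrib]
        simp [hcard]
        ring
      have hmp := measurePreserving_pairs_left n (m n)
      have ht := pi_tail γ hφm (C := C)
        (fun i => by simp only [hφ]; split_ifs <;> assumption)
        (fun i => by simp only [hφ]; split_ifs <;> assumption)
        (fun i => by
          simp only [hφ]
          split_ifs
          · rw [← hA2]; linarith
          · rw [← hB2]; linarith)
        (fun i => by
          simp only [hφ]
          split_ifs
          · rw [← hA4]; linarith
          · rw [← hB4]; linarith)
        (mul_pos hε hn0)
      rw [Fintype.card_fin] at ht
      refine le_trans (le_of_eq ?_) ht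
      rw [← hmp.measure_preimage (measurableSet_le measurable_const
        (by fun_prop)).nullMeasurableSet]
      refine congrArg _ (Set.ext fun q => ?_)
      simp only [Set.mem_preimage, Set.mem_ofPred_eq, hsum]
      rfl
  have hkt := hk.comp (tendsto_fst_tailFilter (μ := fun n => rotLaw n (m n) (k n)))
  have h2 := key.add ((hkt.mul_const a).add ((hkt.const_sub 1).mul_const b))
  rw [zero_add] at h2
  refine h2.congr' ?_
  filter_upwards [tendsto_fst_tailFilter.eventually_gt_atTop 0] with p hp
  have hp0 : (0 : ℝ) < p.1 := by exact_mod_cast hp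
  simp only [Function.comp_apply]
  field_simp
  ring

/-- Law of large numbers for the pairs `(w r, g r)`. -/
theorem tendsto_noise_average (hm : Tendsto (fun n => (m n : ℝ) / n) atTop (𝓝 r))
    {ψ : ℝ × ℝ → ℝ} (hψm : Measurable ψ) (hψ : MemLp ψ 4 (stdGaussian.prod stdGaussian)) :
    Tendsto (fun p : Σ n, RotSpace n (m n) => (∑ i, ψ (p.2.2.1.2 i, p.2.2.2.2 i)) / p.1)
      (tailFilter fun n => rotLaw n (m n) (k n))
      (𝓝 (r * ∫ p, ψ p ∂(stdGaussian.prod stdGaussian))) := by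
  set γ := stdGaussian.prod stdGaussian
  set a := ∫ p, ψ p ∂γ
  have hA : MemLp (fun p => ψ p - a) 4 γ := hψ.sub (memLp_const a)
  have hA1 : ∫ p, (ψ p - a) ∂γ = 0 := by
    rw [integral_sub (hψ.integrable (by norm_num)) (integrable_const a)]; simp [a]
  set A2 := ∫ p, (ψ p - a) ^ 2 ∂γ with hA2
  set A4 := ∫ p, (ψ p - a) ^ 4 ∂γ with hA4
  have hA2' : 0 ≤ A2 := integral_nonneg fun _ => by positivity
  have hA4' : 0 ≤ A4 := integral_nonneg fun _ => by positivity
  obtain ⟨C, hC⟩ : ∃ C, C = 1 + A2 + A4 := ⟨_, rfl⟩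
  have hC3 : C ≤ 3 * C ^ 2 := by nlinarith
  have key : Tendsto (fun p : Σ n, RotSpace n (m n) =>
      (∑ i, ψ (p.2.2.1.2 i, p.2.2.2.2 i) - m p.1 * a) / p.1)
      (tailFilter fun n => rotLaw n (m n) (k n)) (𝓝 0) := by
    refine tendsto_div_of_tail (D := 3 * C ^ 2 * (r + 1) ^ 2) (fun ε hε => ?_)
    filter_upwards [eventually_gt_atTop 0, hm.eventually_lt_const (lt_add_one r)] with n hn hmn
    have hn0 : (0 : ℝ) < n := by exact_mod_cast hn
    rw [div_lt_iff₀ hn0] at hmn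
    refine uniformPatterns_prod_le ?_ fun S hS => ?_
    · refine measurableSet_le measurable_const (Measurable.abs ?_)
      refine Measurable.sub_const ?_ _
      change Measurable fun e : RotSpace n (m n) => ∑ i, ψ (e.2.1.2 i, e.2.2.2 i)
      exact Finset.measurable_fun_sum Finset.univ fun i _ => by fun_prop
    · have hmp := measurePreserving_pairs_right n (m n)
      have ht := pi_tail (ι := Fin (m n)) γ (φ := fun _ p => ψ p - a) (fun _ => by fun_prop)
        (C := C) (fun _ => hA) (fun _ => hA1)
        (fun i => by rw [← hA2]; linarith)
        (fun i => by rw [← hA4]; linarith)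
        (mul_pos hε hn0)
      rw [Fintype.card_fin] at ht
      refine (le_trans (le_of_eq ?_) ht).trans (ENNReal.ofReal_le_ofReal ?_)
      · rw [← hmp.measure_preimage (measurableSet_le measurable_const
          (by fun_prop)).nullMeasurableSet]
        refine congrArg _ (Set.ext fun q => ?_)
        simp [Finset.sum_sub_distrib]
      · have : (m n : ℝ) ^ 2 ≤ ((r + 1) * n) ^ 2 := by gcongr
        rw [mul_pow] at this
        rw [mul_assoc (3 * C ^ 2)]
        gcongr
  have h2 := key.add ((hm.comp (tendsto_fst_tailFilter
    (μ := fun n => rotLaw n (m n) (k n)))).mul_const a)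
  rw [zero_add] at h2
  refine h2.congr' ?_
  filter_upwards [tendsto_fst_tailFilter.eventually_gt_atTop 0] with p hp
  have hp0 : (0 : ℝ) < p.1 := by exact_mod_cast hp
  simp only [Function.comp_apply]
  field_simp
  ring

end LawOfLargeNumbers

theorem memLp_mul_four {Ω : Type*} [MeasurableSpace Ω] {μ : Measure Ω} {f g : Ω → ℝ}
    (hf : MemLp f 8 μ) (hg : MemLp g 8 μ) : MemLp (fun ω => f ω * g ω) 4 μ := by
  have : ENNReal.HolderTriple 8 8 4 := ⟨by
    rw [← two_mul, show (8 : ℝ≥0∞) = 2 * 4 by norm_num, ENNReal.mul_inv (by simp) (by simp),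
      ← mul_assoc, ENNReal.mul_inv_cancel (by simp) (by simp), one_mul]⟩
  exact hg.mul' hf

theorem memLp_fst_stdGaussian :
    MemLp (fun p : ℝ × ℝ => p.1) 8 (stdGaussian.prod stdGaussian) :=
  (memLp_id_gaussianReal (μ := 0) (v := 1) 8).comp_fst _

theorem memLp_snd_stdGaussian :
    MemLp (fun p : ℝ × ℝ => p.2) 8 (stdGaussian.prod stdGaussian) :=
  (memLp_id_gaussianReal (μ := 0) (v := 1) 8).comp_snd _

theorem integral_sq_stdGaussian : ∫ x, x * x ∂stdGaussian = 1 := by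
  have h := variance_of_integral_eq_zero (μ := gaussianReal 0 1) (X := fun x => x)
    aemeasurable_id' integral_id_gaussianReal
  rw [variance_fun_id_gaussianReal] at h
  simp_rw [← sq]
  exact_mod_cast h.symm

theorem integral_fst_sq : ∫ p, p.1 * p.1 ∂(stdGaussian.prod stdGaussian) = 1 := by
  rw [integral_fun_fst (fun x : ℝ => x * x), integral_sq_stdGaussian]
  simp

theorem integral_snd_sq : ∫ p, p.2 * p.2 ∂(stdGaussian.prod stdGaussian) = 1 := by
  rw [integral_fun_snd (fun x : ℝ => x * x), integral_sq_stdGaussian]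
  simp

theorem integral_fst_mul_snd : ∫ p, p.1 * p.2 ∂(stdGaussian.prod stdGaussian) = 0 := by
  rw [integral_prod_mul (fun x : ℝ => x) (fun x : ℝ => x)]
  simp [stdGaussian]

theorem isProbabilityMeasure_sparseGaussian {κ : ℝ} (h0 : 0 ≤ κ) (h1 : κ ≤ 1) :
    IsProbabilityMeasure (sparseGaussian κ) := ⟨by
  simp only [sparseGaussian, Measure.coe_add, Measure.coe_smul, Pi.add_apply, Pi.smul_apply,
    measure_univ, smul_eq_mul, mul_one]
  rw [← ENNReal.ofReal_add (by linarith) h0]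
  simp⟩

theorem integral_mfLimit {κ σ : ℝ} (h0 : 0 ≤ κ) (h1 : κ ≤ 1) {F : ℝ × ℝ → ℝ}
    (hF : Continuous F) (hb : ∀ p, |F p| ≤ 1) :
    ∫ p, F p ∂mfLimit κ σ = κ * ∫ p, F (p.1, p.1 + σ * p.2) ∂(stdGaussian.prod stdGaussian)
      + (1 - κ) * ∫ p, F (0, 0 + σ * p.2) ∂(stdGaussian.prod stdGaussian) := by
  have hc : Continuous fun p : ℝ × ℝ => F (p.1, p.1 + σ * p.2) := by fun_prop
  have := isProbabilityMeasure_sparseGaussian h0 h1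
  have hint (μ : Measure (ℝ × ℝ)) [IsFiniteMeasure μ] :
      Integrable (fun p : ℝ × ℝ => F (p.1, p.1 + σ * p.2)) μ :=
    .of_bound hc.aestronglyMeasurable 1 (ae_of_all _ fun p => hb _)
  rw [mfLimit, integral_map (by fun_prop) hF.aestronglyMeasurable,
    integral_prod _ (hint _), integral_prod _ (hint _)]
  have hi (μ : Measure ℝ) [IsFiniteMeasure μ] :
      Integrable (fun x => ∫ y, F (x, x + σ * y) ∂stdGaussian) μ :=
    (hint (μ.prod stdGaussian)).integral_prod_left
  have e := integral_fun_snd (μ := stdGaussian) (ν := stdGaussian) (fun y => F (0, 0 + σ * y))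
  rw [e, sparseGaussian, integral_add_measure ((hi _).smul_measure (by simp))
    ((hi _).smul_measure (by simp)), integral_smul_measure, integral_smul_measure, integral_dirac,
    ENNReal.toReal_ofReal h0, ENNReal.toReal_ofReal (by linarith)]
  simp
  ring

theorem isProbabilityMeasure_mfLimit {κ σ : ℝ} (h0 : 0 ≤ κ) (h1 : κ ≤ 1) :
    IsProbabilityMeasure (mfLimit κ σ) := by
  have := isProbabilityMeasure_sparseGaussian h0 h1
  exact Measure.isProbabilityMeasure_map (by fun_prop)

/-- The rescaled estimate is a linear combination of the signal and the fresh Gaussian vector. -/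
theorem rotEst_eq {n m k : ℕ} {SNR : ℝ} (hS : 0 < SNR) (hn : 0 < n) (hm : 0 < m) (hk : 0 < k)
    (ω : RotSpace n m) {N q G H V : ℝ} (hN : N = (∑ i, rotX n m ω i * rotX n m ω i) / n)
    (hq : q = (∑ i, rotX n m ω i * ω.2.2.1 i) / n)
    (hV : V = (∑ i, ω.2.1.2 i * ω.2.1.2 i) / n)
    (hH : H = (∑ i, ω.2.1.2 i * ω.2.2.2 i) / n)
    (hG : G = (∑ i, ω.2.2.2 i * ω.2.2.2 i) / n) (hN0 : 0 < N) {u B : ℝ}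
    (hu : u = √((k : ℝ) / n / SNR))
    (hB : B = √((N * G + 2 * u * √N * H + u ^ 2 * V) / ((m : ℝ) / n) ^ 2)) (i : Fin n) :
    rotEst n m SNR k ω i
      = ((G + u * H / √N) / ((m : ℝ) / n) - B * (q / N)) * rotX n m ω i + B * ω.2.2.1 i := by
  have hn' : (0 : ℝ) < n := by exact_mod_cast hn
  have hm' : (0 : ℝ) < m := by exact_mod_cast hm
  have hk' : (0 : ℝ) < k := by exact_mod_cast hk
  obtain ⟨ν, hν⟩ : ∃ ν, ν = √(n : ℝ) := ⟨_, rfl⟩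
  have hν0 : 0 < ν := hν ▸ Real.sqrt_pos.2 hn'
  have hν2 : (n : ℝ) = ν ^ 2 := by rw [hν, Real.sq_sqrt hn'.le]
  have hu0 : 0 < u := hu ▸ Real.sqrt_pos.2 (by positivity)
  obtain ⟨ρ, hρ⟩ : ∃ ρ, ρ = √N := ⟨_, rfl⟩
  have hρ0 : 0 < ρ := hρ ▸ Real.sqrt_pos.2 hN0
  have hρ2 : N = ρ ^ 2 := by rw [hρ, Real.sq_sqrt hN0.le]
  have e1 : √(k / SNR) = u * ν := by
    rw [hu, hν, ← Real.sqrt_mul (by positivity)]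
    congr 1
    field_simp
  have e2 : √(SNR / k) = 1 / (u * ν) := by
    rw [← e1, one_div, ← Real.sqrt_inv, inv_div]
  have e3 : ∑ i, rotX n m ω i ^ 2 = (ρ * ν) ^ 2 := by
    rw [mul_pow, ← hρ2, ← hν2, hN, div_mul_cancel₀ _ hn'.ne']
    exact Finset.sum_congr rfl fun _ _ => sq _
  have e4 : √(∑ i, rotX n m ω i ^ 2) = ρ * ν := by
    rw [e3, Real.sqrt_sq (by positivity)]
  have hY (r : Fin m) : rotY n m SNR k ω r = ρ / u * ω.2.2.2 r + ω.2.1.2 r := by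
    rw [rotY, obsOf, e2, e4]
    field_simp
  have hGY : ∑ r, ω.2.2.2 r * rotY n m SNR k ω r = ν ^ 2 * (ρ / u * G + H) := by
    have : ∀ r, ω.2.2.2 r * rotY n m SNR k ω r
        = ρ / u * (ω.2.2.2 r * ω.2.2.2 r) + ω.2.1.2 r * ω.2.2.2 r := fun r => by rw [hY]; ring
    simp_rw [this, Finset.sum_add_distrib, ← Finset.mul_sum]
    rw [hG, hH, ← hν2]
    field_simp
  have hYY : ∑ r, rotY n m SNR k ω r ^ 2
      = ν ^ 2 * ((ρ / u) ^ 2 * G + 2 * (ρ / u) * H + V) := by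
    have : ∀ r, rotY n m SNR k ω r ^ 2 = (ρ / u) ^ 2 * (ω.2.2.2 r * ω.2.2.2 r)
        + 2 * (ρ / u) * (ω.2.1.2 r * ω.2.2.2 r) + ω.2.1.2 r * ω.2.1.2 r := fun r => by
      rw [hY]; ring
    simp_rw [this, Finset.sum_add_distrib, ← Finset.mul_sum]
    rw [hG, hH, hV, ← hν2]
    field_simp
  have hBY : 1 / (m : ℝ) * (u * ν) * √(∑ r, rotY n m SNR k ω r ^ 2) = B := by
    rw [hB, ← Real.sqrt_sq (show 0 ≤ 1 / (m : ℝ) * (u * ν) by positivity),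
      ← Real.sqrt_mul (by positivity), hYY, ← hρ, hρ2, hν2]
    congr 1
    field_simp
  have hz : ∑ j, √(∑ r, rotY n m SNR k ω r ^ 2) * ω.2.2.1 j * unitDir (rotX n m ω) j
      = √(∑ r, rotY n m SNR k ω r ^ 2) * (q * ν / ρ) := by
    have : ∀ j, √(∑ r, rotY n m SNR k ω r ^ 2) * ω.2.2.1 j * unitDir (rotX n m ω) j
        = √(∑ r, rotY n m SNR k ω r ^ 2) * (rotX n m ω j * ω.2.2.1 j) / (ρ * ν) := fun j => by
      rw [unitDir, e4]; ring
    simp_rw [this, ← Finset.sum_div, ← Finset.mul_sum]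
    rw [hq, hν2]
    field_simp
  rw [rotEst, replaceDir, e1, hz, hGY, unitDir, e4, ← hBY, ← hρ, hν2, hρ2]
  field_simp
  ring

theorem uniformPatterns_univ {n k : ℕ} (h : k ≤ n) : uniformPatterns n k Set.univ = 1 := by
  have hc : (patterns n k).card ≠ 0 := by
    rw [patterns, Finset.card_powersetCard, Finset.card_univ, Fintype.card_fin]
    exact (Nat.choose_pos h).ne'
  simp [uniformPatterns, ENNReal.inv_mul_cancel (Nat.cast_ne_zero.2 hc) (ENNReal.natCast_ne_top _)]

instance (n m k : ℕ) : IsFiniteMeasure (mfLaw n m k) := by unfold mfLaw; infer_instance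

theorem mfLaw_ne_zero {n k : ℕ} (m : ℕ) (h : k ≤ n) : mfLaw n m k ≠ 0 := by
  rw [← Measure.measure_univ_ne_zero, mfLaw, ← Set.univ_prod_univ, Measure.prod_prod,
    uniformPatterns_univ h]
  simp

theorem integral_empirical {n : ℕ} (x y : Fin n → ℝ) (f : ℝ × ℝ → ℝ) :
    ∫ p, f p ∂empirical n x y = (∑ i, f (x i, y i)) / n := by
  rw [empirical, integral_smul_measure, integral_finsetSum_measure
    fun i _ => integrable_dirac (by simp)]
  simp [integral_dirac, div_eq_inv_mul]

theorem isProbabilityMeasure_empirical {n : ℕ} (hn : n ≠ 0) (x y : Fin n → ℝ) :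
    IsProbabilityMeasure (empirical n x y) := ⟨by
  simp [empirical, ENNReal.inv_mul_cancel (Nat.cast_ne_zero.2 hn) (ENNReal.natCast_ne_top _)]⟩

section LawOfLargeNumbers

variable {k m : ℕ → ℕ} {κ r SNR σ : ℝ}

/-- Averages of a bounded Lipschitz function over the pairs (signal, estimate). -/
theorem tendsto_rot_average (hκ : 0 < κ) (hκ1 : κ ≤ 1) (hSNR : 0 < SNR) (hr : 0 < r)
    (hk : Tendsto (fun n => (k n : ℝ) / n) atTop (𝓝 κ))
    (hm : Tendsto (fun n => (m n : ℝ) / n) atTop (𝓝 r))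
    (hσ0 : 0 ≤ σ) (hσ : σ ^ 2 = κ / r * (1 / SNR + 1)) {F : ℝ × ℝ → ℝ} {K : ℝ≥0}
    (hF : LipschitzWith K F) (hb : ∀ p, |F p| ≤ 1) :
    Tendsto (fun p : Σ n, RotSpace n (m n) =>
        (∑ i, F (rotX p.1 (m p.1) p.2 i, rotEst p.1 (m p.1) SNR (k p.1) p.2 i)) / p.1)
      (tailFilter fun n => rotLaw n (m n) (k n)) (𝓝 (∫ p, F p ∂mfLimit κ σ)) := by
  set l := tailFilter fun n => rotLaw n (m n) (k n)
  have hl : Tendsto (Sigma.fst : (Σ n, RotSpace n (m n)) → ℕ) l atTop := tendsto_fst_tailFilter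
  have hFc : Continuous F := hF.continuous
  set N : (Σ n, RotSpace n (m n)) → ℝ := fun p =>
    (∑ i, rotX p.1 (m p.1) p.2 i * rotX p.1 (m p.1) p.2 i) / p.1
  set q : (Σ n, RotSpace n (m n)) → ℝ := fun p =>
    (∑ i, rotX p.1 (m p.1) p.2 i * p.2.2.2.1 i) / p.1
  set Z : (Σ n, RotSpace n (m n)) → ℝ := fun p => (∑ i, p.2.2.2.1 i * p.2.2.2.1 i) / p.1
  set V : (Σ n, RotSpace n (m n)) → ℝ := fun p => (∑ i, p.2.2.1.2 i * p.2.2.1.2 i) / p.1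
  set H : (Σ n, RotSpace n (m n)) → ℝ := fun p => (∑ i, p.2.2.1.2 i * p.2.2.2.2 i) / p.1
  set G : (Σ n, RotSpace n (m n)) → ℝ := fun p => (∑ i, p.2.2.2.2 i * p.2.2.2.2 i) / p.1
  have m1 := memLp_fst_stdGaussian
  have m2 := memLp_snd_stdGaussian
  have hN : Tendsto N l (𝓝 κ) := by
    simpa [integral_fst_sq] using tendsto_signal_average (m := m) hk
      (ψ := fun p => p.1 * p.1) (by fun_prop) (memLp_mul_four m1 m1) (by simp)
  have hq : Tendsto q l (𝓝 0) := by
    simpa [integral_fst_mul_snd] using tendsto_signal_average (m := m) hk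
      (ψ := fun p => p.1 * p.2) (by fun_prop) (memLp_mul_four m1 m2) (by simp)
  have hZ : Tendsto Z l (𝓝 1) := by
    simpa [integral_snd_sq] using tendsto_signal_average (m := m) hk
      (ψ := fun p => p.2 * p.2) (by fun_prop) (memLp_mul_four m2 m2) (memLp_mul_four m2 m2)
  have hV : Tendsto V l (𝓝 r) := by
    simpa [integral_fst_sq] using tendsto_noise_average (k := k) hm
      (ψ := fun p => p.1 * p.1) (by fun_prop) (memLp_mul_four m1 m1)
  have hH : Tendsto H l (𝓝 0) := by
    simpa [integral_fst_mul_snd] using tendsto_noise_average (k := k) hm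
      (ψ := fun p => p.1 * p.2) (by fun_prop) (memLp_mul_four m1 m2)
  have hG : Tendsto G l (𝓝 r) := by
    simpa [integral_snd_sq] using tendsto_noise_average (k := k) hm
      (ψ := fun p => p.2 * p.2) (by fun_prop) (memLp_mul_four m2 m2)
  have hmain : Tendsto (fun p : Σ n, RotSpace n (m n) =>
      (∑ i, F (rotX p.1 (m p.1) p.2 i, rotX p.1 (m p.1) p.2 i + σ * p.2.2.2.1 i)) / p.1) l
      (𝓝 (∫ p, F p ∂mfLimit κ σ)) := by
    rw [integral_mfLimit hκ.le hκ1 hFc hb]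
    have hψ : Continuous fun p : ℝ × ℝ => F (p.1, p.1 + σ * p.2) := by fun_prop
    have hψ0 : Continuous fun p : ℝ × ℝ => F (0, 0 + σ * p.2) := by fun_prop
    exact tendsto_signal_average (m := m) hk (ψ := fun p => F (p.1, p.1 + σ * p.2))
      hψ.measurable (.of_bound hψ.aestronglyMeasurable 1 (ae_of_all _ fun p => hb _))
      (.of_bound hψ0.aestronglyMeasurable 1 (ae_of_all _ fun p => hb _))
  have hkl := hk.comp hl
  have hml := hm.comp hl
  obtain ⟨u, hu⟩ : ∃ u : (Σ n, RotSpace n (m n)) → ℝ,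
    u = fun p => √((k p.1 : ℝ) / p.1 / SNR) := ⟨_, rfl⟩
  have hul : Tendsto u l (𝓝 √(κ / SNR)) := hu ▸ (hkl.div_const SNR).sqrt
  obtain ⟨B, hB⟩ : ∃ B : (Σ n, RotSpace n (m n)) → ℝ, B = fun p =>
    √((N p * G p + 2 * u p * √(N p) * H p + u p ^ 2 * V p) / ((m p.1 : ℝ) / p.1) ^ 2) := ⟨_, rfl⟩
  have hBl : Tendsto B l (𝓝 σ) := by
    have h := ((((hN.mul hG).add (((hul.const_mul 2).mul hN.sqrt).mul hH)).add
      ((hul.pow 2).mul hV)).div (hml.pow 2) (by positivity)).sqrt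
    rw [Real.sq_sqrt (by positivity)] at h
    convert h using 2
    · rw [hB]; rfl
    · rw [← Real.sqrt_sq hσ0, hσ]
      congr 1
      field_simp
      ring
  have hAl : Tendsto (fun p => (G p + u p * H p / √(N p)) / ((m p.1 : ℝ) / p.1)
      - B p * (q p / N p)) l (𝓝 1) := by
    have h := ((hG.add ((hul.mul hH).div hN.sqrt (by positivity))).div hml hr.ne').sub
      (hBl.mul (hq.div hN hκ.ne'))
    rwa [mul_zero, zero_div, zero_div, mul_zero, add_zero, sub_zero, div_self hr.ne'] at h
  have herr : Tendsto (fun p : Σ n, RotSpace n (m n) =>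
      K * (|(G p + u p * H p / √(N p)) / ((m p.1 : ℝ) / p.1) - B p * (q p / N p) - 1| * (1 + N p)
        + |B p - σ| * (1 + Z p))) l (𝓝 0) := by
    have h := ((((hAl.sub_const 1).abs.mul (hN.const_add 1)).add
      ((hBl.sub_const σ).abs.mul (hZ.const_add 1))).const_mul (K : ℝ))
    simpa using h
  have hdiff : Tendsto (fun p : Σ n, RotSpace n (m n) =>
      (∑ i, F (rotX p.1 (m p.1) p.2 i, rotEst p.1 (m p.1) SNR (k p.1) p.2 i)) / p.1
      - (∑ i, F (rotX p.1 (m p.1) p.2 i, rotX p.1 (m p.1) p.2 i + σ * p.2.2.2.1 i)) / p.1) l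
      (𝓝 0) := by
    refine squeeze_zero_norm' ?_ herr
    filter_upwards [hl.eventually_gt_atTop 0, hN.eventually_const_lt hκ,
      hkl.eventually_const_lt hκ, hml.eventually_const_lt hr] with p hn hNp hkp hmp
    have hn' : (0 : ℝ) < p.1 := by exact_mod_cast hn
    have hk0 : 0 < k p.1 := Nat.pos_of_ne_zero fun h => by simp [h] at hkp
    have hm0 : 0 < m p.1 := Nat.pos_of_ne_zero fun h => by simp [h] at hmp
    obtain ⟨A, hA⟩ : ∃ A, A = (G p + u p * H p / √(N p)) / ((m p.1 : ℝ) / p.1)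
      - B p * (q p / N p) := ⟨_, rfl⟩
    have hE (i : Fin p.1) : rotEst p.1 (m p.1) SNR (k p.1) p.2 i
        = A * rotX p.1 (m p.1) p.2 i + B p * p.2.2.2.1 i := by
      rw [hA]
      exact rotEst_eq hSNR hn hm0 hk0 p.2 rfl rfl rfl rfl rfl hNp (by rw [hu]) (by rw [hB]) i
    have habs (x : ℝ) : |x| ≤ 1 + x * x := by
      rcases abs_cases x with ⟨h, _⟩ | ⟨h, _⟩ <;> nlinarith [sq_nonneg (x - 1), sq_nonneg (x + 1)]
    have hterm (i : Fin p.1) :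
        |F (rotX p.1 (m p.1) p.2 i, rotEst p.1 (m p.1) SNR (k p.1) p.2 i)
          - F (rotX p.1 (m p.1) p.2 i, rotX p.1 (m p.1) p.2 i + σ * p.2.2.2.1 i)|
        ≤ K * (|A - 1| * (1 + rotX p.1 (m p.1) p.2 i * rotX p.1 (m p.1) p.2 i)
          + |B p - σ| * (1 + p.2.2.2.1 i * p.2.2.2.1 i)) := by
      rw [← Real.dist_eq]
      refine (hF.dist_le_mul _ _).trans (mul_le_mul_of_nonneg_left ?_ K.2)
      rw [Prod.dist_eq, dist_self, max_eq_right dist_nonneg, Real.dist_eq, hE]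
      have e : A * rotX p.1 (m p.1) p.2 i + B p * p.2.2.2.1 i
          - (rotX p.1 (m p.1) p.2 i + σ * p.2.2.2.1 i)
          = (A - 1) * rotX p.1 (m p.1) p.2 i + (B p - σ) * p.2.2.2.1 i := by ring
      rw [e]
      refine (abs_add_le _ _).trans ?_
      rw [abs_mul, abs_mul]
      gcongr <;> exact habs _
    rw [← sub_div, ← Finset.sum_sub_distrib, Real.norm_eq_abs, abs_div, abs_of_pos hn', ← hA]
    calc _ ≤ (∑ i, K * (|A - 1| * (1 + rotX p.1 (m p.1) p.2 i * rotX p.1 (m p.1) p.2 i)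
          + |B p - σ| * (1 + p.2.2.2.1 i * p.2.2.2.1 i))) / p.1 := by
          gcongr
          exact (Finset.abs_sum_le_sum_abs _ _).trans (Finset.sum_le_sum fun i _ => hterm i)
      _ = _ := by
          simp only [← Finset.mul_sum, Finset.sum_add_distrib, Finset.sum_const, Finset.card_univ,
            Fintype.card_fin, nsmul_eq_mul, mul_one, N, Z]
          field_simp
  simpa using hdiff.add hmain

/-- Averages of a bounded Lipschitz function over the pairs (signal, matched filter estimate). -/
theorem tendsto_mf_average (hκ : 0 < κ) (hκ1 : κ ≤ 1) (hSNR : 0 < SNR) (hr : 0 < r)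
    (hk : Tendsto (fun n => (k n : ℝ) / n) atTop (𝓝 κ))
    (hm : Tendsto (fun n => (m n : ℝ) / n) atTop (𝓝 r))
    (hσ0 : 0 ≤ σ) (hσ : σ ^ 2 = κ / r * (1 / SNR + 1)) {F : ℝ × ℝ → ℝ} {K : ℝ≥0}
    (hF : LipschitzWith K F) (hb : ∀ p, |F p| ≤ 1) :
    Tendsto (fun p : Σ n, MFSpace n (m n) =>
        (∑ i, F (Xvec p.1 (m p.1) p.2 i, mfEst p.1 (m p.1) SNR (k p.1) p.2 i)) / p.1)
      (tailFilter fun n => mfLaw n (m n) (k n)) (𝓝 (∫ p, F p ∂mfLimit κ σ)) := by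
  have hFm : Measurable F := hF.continuous.measurable
  have hD (n : ℕ) : Measurable fun p : (Fin n → ℝ) × (Fin n → ℝ) =>
      (∑ i, F (p.1 i, p.2 i)) / n :=
    (Finset.measurable_fun_sum Finset.univ fun i _ => by fun_prop).div_const _
  refine tendsto_tailFilter_of_map_eq (fun n => (hD n).comp (measurable_mf_pair n (m n) SNR (k n)))
    (fun n => (hD n).comp (measurable_rot_pair n (m n) SNR (k n))) (fun n => ?_)
    (tendsto_rot_average hκ hκ1 hSNR hr hk hm hσ0 hσ hF hb)
  have h := congrArg (Measure.map fun p : (Fin n → ℝ) × (Fin n → ℝ) =>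
    (∑ i, F (p.1 i, p.2 i)) / n) (map_mfLaw_eq_map_rotLaw n (m n) SNR (k n))
  rwa [Measure.map_map (hD n) (measurable_mf_pair n (m n) SNR (k n)),
    Measure.map_map (hD n) (measurable_rot_pair n (m n) SNR (k n))] at h

end LawOfLargeNumbers

/-- **Proposition 1** (Matched filter state evolution). The empirical joint distribution
of the pairs `(X(i), X̂^MF(i))` converges weakly, almost surely, to the law of
`(X̄, X̄ + σ·W̄)` with `σ² = (κ/r)(1/SNR + 1)`. -/
theorem matched_filter_state_evolution
    (κ SNR r : ℝ) (hκ : κ ∈ Set.Ioo 0 (1/2)) (hSNR : 0 < SNR) (hr : 0 < r)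
    (k m : ℕ → ℕ)
    (hk : Tendsto (fun n => (k n : ℝ) / n) atTop (𝓝 κ))
    (hm : Tendsto (fun n => (m n : ℝ) / n) atTop (𝓝 r))
    (σ : ℝ) (hσ0 : 0 ≤ σ) (hσ : σ ^ 2 = κ / r * (1 / SNR + 1))
    (Ω : Type) [MeasurableSpace Ω] (P : Measure Ω) [IsProbabilityMeasure P]
    (Rv : ∀ n, Ω → MFSpace n (m n))
    (hRv : ∀ n, Measure.map (Rv n) P = mfLaw n (m n) (k n)) :
    ∀ᵐ ω ∂P, ∀ f : BoundedContinuousFunction (ℝ × ℝ) ℝ,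
      Tendsto
        (fun n => ∫ p, f p ∂ empirical n (Xvec n (m n) (Rv n ω))
          (mfEst n (m n) SNR (k n) (Rv n ω)))
        atTop (𝓝 (∫ p, f p ∂ mfLimit κ σ)) := by
  obtain ⟨hκ0, hκ2⟩ := hκ
  have hκ1 : κ ≤ 1 := by linarith
  have hRv' : ∀ᶠ n in atTop, AEMeasurable (Rv n) P ∧ P.map (Rv n) = mfLaw n (m n) (k n) := by
    filter_upwards [eventually_gt_atTop 0,
      hk.eventually_lt_const (show κ < 1 by linarith)] with n hn hkn
    have hn' : (0 : ℝ) < n := by exact_mod_cast hn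
    have hle : k n ≤ n := by
      rw [div_lt_one hn'] at hkn
      exact_mod_cast hkn.le
    refine ⟨?_, hRv n⟩
    by_contra hmeas
    exact mfLaw_ne_zero (m n) hle ((hRv n).symm.trans (Measure.map_of_not_aemeasurable hmeas))
  obtain ⟨F, hF, hb, htest⟩ := exists_countable_lipschitz_tests (ℝ × ℝ)
  have hlim (j) : ∀ᵐ ω ∂P, Tendsto (fun n => (∑ i, F j (Xvec n (m n) (Rv n ω) i,
      mfEst n (m n) SNR (k n) (Rv n ω) i)) / n) atTop (𝓝 (∫ p, F j p ∂mfLimit κ σ)) := by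
    obtain ⟨K, hK⟩ := hF j
    exact ae_tendsto_of_tendsto_tailFilter hRv'
      (tendsto_mf_average hκ0 hκ1 hSNR hr hk hm hσ0 hσ hK (hb j))
  have hprob : IsProbabilityMeasure (mfLimit κ σ) := isProbabilityMeasure_mfLimit hκ0.le hκ1
  filter_upwards [ae_all_iff.2 hlim] with ω hω f
  refine (tendsto_add_atTop_iff_nat 1).1 (htest (mfLimit κ σ)
    (fun n => empirical (n + 1) (Xvec (n + 1) (m (n + 1)) (Rv (n + 1) ω))
      (mfEst (n + 1) (m (n + 1)) SNR (k (n + 1)) (Rv (n + 1) ω))) hprob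
    (fun n => isProbabilityMeasure_empirical n.succ_ne_zero _ _) (fun j => ?_) f)
  refine ((tendsto_add_atTop_iff_nat 1).2 (hω j)).congr fun n => ?_
  rw [integral_empirical]

end Sparsity
end
end

section
/- (High-SNR achievability.) Fix κ ∈ (0,1/2), diversity J, and a target distortion α > 0, and let ρ(SNR) denote the infimum over total sampling rates ρ such that distortion α is achievable by the optimal (unrestricted) estimator in the joint sparsity model. Then for every ε > 0 there exists SNR_0 such that for all SNR ≥ SNR_0, ρ(SNR) ≤ J·κ + 2·H_b(κ)·(1+ε)/log(SNR). -/
open MeasureTheory ProbabilityTheory Real Filter Finset Topology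
open scoped ENNReal NNReal

noncomputable section

namespace Sparsity

variable {ι : Type*} [Fintype ι]

/-- The coordinates of a standard gaussian vector along an orthonormal family are i.i.d.
standard gaussian. -/
lemma gaussianPi_map_orthonormal {κ : Type*} [Fintype κ] {u : κ → EuclideanSpace ℝ ι}
    (hu : Orthonormal ℝ u) :
    (gaussianPi ι).map (fun h l => ∑ i, u l i * h i) = gaussianPi κ := by
  have hmeas : Measurable (fun (h : ι → ℝ) (l : κ) => ∑ i, u l i * h i) := by fun_prop
  have : IsProbabilityMeasure ((gaussianPi ι).map (fun h l => ∑ i, u l i * h i)) :=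
    Measure.isProbabilityMeasure_map hmeas.aemeasurable
  have key : ((gaussianPi ι).map (fun h l => ∑ i, u l i * h i)).map (WithLp.toLp 2)
      = (gaussianPi κ).map (WithLp.toLp 2) := by
    have : IsProbabilityMeasure (((gaussianPi ι).map (fun h l => ∑ i, u l i * h i)).map
      (WithLp.toLp 2)) := Measure.isProbabilityMeasure_map (by fun_prop)
    have : IsProbabilityMeasure ((gaussianPi κ).map (WithLp.toLp 2)) :=
      Measure.isProbabilityMeasure_map (by fun_prop)
    refine Measure.ext_of_charFun (E := EuclideanSpace ℝ κ) ?_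
    ext t
    have h2 : (gaussianPi κ).map (WithLp.toLp 2)
        = ProbabilityTheory.stdGaussian (EuclideanSpace ℝ κ) := map_pi_eq_stdGaussian
    have h1 : (gaussianPi ι).map (WithLp.toLp 2)
        = ProbabilityTheory.stdGaussian (EuclideanSpace ℝ ι) := map_pi_eq_stdGaussian
    have h3 : charFun (((gaussianPi ι).map (fun h l => ∑ i, u l i * h i)).map (WithLp.toLp 2)) t
        = charFun ((gaussianPi ι).map (WithLp.toLp 2)) (∑ l, t l • u l) := by
      rw [charFun_apply, charFun_apply, Measure.map_map (by fun_prop) hmeas,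
        integral_map ((WithLp.measurable_toLp 2 _).comp hmeas).aemeasurable (by fun_prop),
        integral_map (by fun_prop) (by fun_prop)]
      congr 1
      ext h
      congr 3
      simp only [Function.comp, PiLp.inner_apply, RCLike.inner_apply, conj_trivial,
        WithLp.ofLp_sum, Finset.sum_apply, WithLp.ofLp_smul, Pi.smul_apply,
        smul_eq_mul, Finset.mul_sum, Finset.sum_mul]
      rw [Finset.sum_comm]
      simp only [mul_assoc]
    rw [h3, h1, h2, charFun_stdGaussian, charFun_stdGaussian]
    have h4 : ‖∑ l, t l • u l‖ ^ 2 = ‖t‖ ^ 2 := by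
      rw [← real_inner_self_eq_norm_sq, hu.inner_sum, EuclideanSpace.real_norm_sq_eq]
      simp [sq]
    norm_cast
    rw [h4]
  have := congrArg (Measure.map WithLp.ofLp) key
  have hid (μ : Measure (κ → ℝ)) : (μ.map (WithLp.toLp 2)).map WithLp.ofLp = μ := by
    rw [Measure.map_map (by fun_prop) (by fun_prop)]
    exact Measure.map_id
  rwa [hid, hid] at this

lemma integrable_stdGaussian_exp_neg (L a : ℝ) :
    Integrable (fun x => Real.exp (-(Real.exp (2 * L) / 2 * (x - a) ^ 2))) stdGaussian := by
  refine Integrable.of_bound (C := 1) (by fun_prop) (ae_of_all _ fun x => ?_)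
  rw [Real.norm_eq_abs, abs_of_pos (Real.exp_pos _), Real.exp_le_one_iff]
  have := Real.exp_pos (2 * L)
  nlinarith [mul_nonneg this.le (sq_nonneg (x - a))]

lemma integral_stdGaussian_exp_neg_le (L a : ℝ) :
    ∫ x, Real.exp (-(Real.exp (2 * L) / 2 * (x - a) ^ 2)) ∂stdGaussian ≤ Real.exp (-L) := by
  unfold stdGaussian
  rw [integral_gaussianReal_eq_integral_smul (by norm_num)]
  have hL := Real.exp_pos (2 * L)
  have hintegrable : Integrable fun x : ℝ => Real.exp (-(Real.exp (2 * L) / 2) * (x - a) ^ 2) :=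
    (integrable_exp_neg_mul_sq (by positivity)).comp_sub_right a
  calc ∫ x, gaussianPDFReal 0 1 x • Real.exp (-(Real.exp (2 * L) / 2 * (x - a) ^ 2))
      ≤ ∫ x, (√(2 * π))⁻¹ * Real.exp (-(Real.exp (2 * L) / 2) * (x - a) ^ 2) := by
        refine integral_mono_of_nonneg (ae_of_all _ fun x => ?_) (hintegrable.const_mul _)
          (ae_of_all _ fun x => ?_)
        · exact mul_nonneg (gaussianPDFReal_nonneg _ _ _) (Real.exp_pos _).le
        · simp only [smul_eq_mul, gaussianPDFReal_def, neg_mul, NNReal.coe_one, mul_one, sub_zero]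
          refine mul_le_mul_of_nonneg_right ?_ (Real.exp_pos _).le
          refine mul_le_of_le_one_right (by positivity) ?_
          rw [Real.exp_le_one_iff]
          nlinarith [sq_nonneg x]
    _ = (√(2 * π))⁻¹ * √(π / (Real.exp (2 * L) / 2)) := by
        rw [integral_const_mul,
          integral_sub_right_eq_self (fun x => Real.exp (-(Real.exp (2 * L) / 2) * x ^ 2)) a,
          integral_gaussian]
    _ = Real.exp (-L) := by
        rw [← Real.sqrt_inv, ← Real.sqrt_mul (by positivity)]
        have : (2 * π)⁻¹ * (π / (Real.exp (2 * L) / 2)) = Real.exp (-L) ^ 2 := by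
          rw [← Real.exp_nat_mul, show ((2 : ℕ) : ℝ) * -L = -(2 * L) by push_cast; ring,
            Real.exp_neg]
          field_simp
        rw [this, Real.sqrt_sq (Real.exp_pos _).le]

lemma stdGaussian_exp_sq_aux (x : ℝ) :
    gaussianPDFReal 0 1 x * Real.exp (x ^ 2 / 4) = (√(2 * π))⁻¹ * Real.exp (-(1 / 4) * x ^ 2) := by
  simp only [gaussianPDFReal_def, NNReal.coe_one, mul_one, sub_zero]
  rw [mul_assoc, ← Real.exp_add]
  ring_nf

lemma integrable_stdGaussian_exp_sq :
    Integrable (fun x => Real.exp (x ^ 2 / 4)) stdGaussian := by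
  unfold stdGaussian
  rw [gaussianReal_of_var_ne_zero _ (by norm_num),
    integrable_withDensity_iff_integrable_smul₀' (by fun_prop)
      (ae_of_all _ fun x => by simp [gaussianPDF])]
  simp only [gaussianPDF, ENNReal.toReal_ofReal (gaussianPDFReal_nonneg _ _ _), smul_eq_mul,
    stdGaussian_exp_sq_aux]
  exact (integrable_exp_neg_mul_sq (by norm_num)).const_mul _

lemma integral_stdGaussian_exp_sq_le :
    ∫ x, Real.exp (x ^ 2 / 4) ∂stdGaussian ≤ Real.exp 1 := by
  unfold stdGaussian
  rw [integral_gaussianReal_eq_integral_smul (by norm_num)]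
  simp only [smul_eq_mul, stdGaussian_exp_sq_aux]
  rw [integral_const_mul, integral_gaussian, ← Real.sqrt_inv, ← Real.sqrt_mul (by positivity)]
  have h1 : (2 * π)⁻¹ * (π / (1 / 4)) = 2 := by
    field_simp
    norm_num
  rw [h1]
  have h2 : √2 ≤ 2 := by
    rw [Real.sqrt_le_left (by norm_num)]; norm_num
  linarith [Real.add_one_le_exp (1 : ℝ)]

/-- Chernoff bound for a product of functions of independent standard gaussians. -/
lemma gaussianPi_prod_ge_le (f : ι → ℝ → ℝ) (hf0 : ∀ i x, 0 ≤ f i x)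
    (hf : ∀ i, Integrable (f i) stdGaussian) {a b : ℝ}
    (hb : ∏ i, ∫ x, f i x ∂stdGaussian ≤ Real.exp b) :
    gaussianPi ι {h | Real.exp a ≤ ∏ i, f i (h i)} ≤ ENNReal.ofReal (Real.exp (b - a)) := by
  have hintegrable : Integrable (fun h : ι → ℝ => ∏ i, f i (h i)) (gaussianPi ι) :=
    Integrable.fintype_prod hf
  have h1 := mul_meas_ge_le_integral_of_nonneg
    (ae_of_all _ fun h : ι → ℝ => Finset.prod_nonneg fun i _ => hf0 i (h i)) hintegrable (Real.exp a)
  have h2 : ∫ h : ι → ℝ, ∏ i, f i (h i) ∂(gaussianPi ι) = ∏ i, ∫ x, f i x ∂stdGaussian :=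
    integral_fintype_prod_eq_prod f
  rw [h2] at h1
  rw [← ENNReal.ofReal_toReal (measure_ne_top (gaussianPi ι) {h | Real.exp a ≤ ∏ i, f i (h i)})]
  refine ENNReal.ofReal_le_ofReal ?_
  rw [Real.exp_sub, le_div_iff₀ (Real.exp_pos _), mul_comm]
  exact h1.trans hb

/-- Small ball estimate for shifted coordinates of a standard gaussian vector. -/
lemma gaussianPi_sum_sq_lt_le (U : Finset ι) (w : ι → ℝ) (t L : ℝ) :
    gaussianPi ι {h | ∑ i ∈ U, (h i - w i) ^ 2 < t}
      ≤ ENNReal.ofReal (Real.exp (Real.exp (2 * L) / 2 * t - L * #U)) := by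
  classical
  set s := Real.exp (2 * L) / 2 with hs
  have hs0 : 0 < s := by positivity
  let f : ι → ℝ → ℝ := fun i x => if i ∈ U then Real.exp (-(s * (x - w i) ^ 2)) else 1
  have hf : ∀ i, Integrable (f i) stdGaussian := by
    intro i
    by_cases hi : i ∈ U
    · simpa [f, hi] using integrable_stdGaussian_exp_neg L (w i)
    · simp [f, hi]
  have hb : ∏ i, ∫ x, f i x ∂stdGaussian ≤ Real.exp (-(L * #U)) := by
    calc ∏ i, ∫ x, f i x ∂stdGaussian
        ≤ ∏ i, if i ∈ U then Real.exp (-L) else 1 := by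
          refine Finset.prod_le_prod (fun i _ => integral_nonneg fun x => ?_) fun i _ => ?_
          · by_cases hi : i ∈ U <;> simp [f, hi, (Real.exp_pos _).le]
          · by_cases hi : i ∈ U
            · simpa [f, hi] using integral_stdGaussian_exp_neg_le L (w i)
            · simp [f, hi]
      _ = Real.exp (-(L * #U)) := by
          rw [Finset.prod_ite_mem, Finset.univ_inter, Finset.prod_const, ← Real.exp_nat_mul]
          ring_nf
  have := gaussianPi_prod_ge_le f
    (fun i x => by by_cases hi : i ∈ U <;> simp [f, hi, (Real.exp_pos _).le]) hf
    (a := -(s * t)) hb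
  refine (measure_mono fun h hh => ?_).trans (this.trans (le_of_eq ?_))
  · simp only [Set.mem_ofPred_eq] at hh ⊢
    rw [Finset.prod_ite_mem, Finset.univ_inter, ← Real.exp_sum, Real.exp_le_exp,
      Finset.sum_neg_distrib, ← Finset.mul_sum]
    nlinarith
  · congr 2; ring

lemma gaussianPi_sum_sq_ge_le (t : ℝ) :
    gaussianPi ι {h | t ≤ ∑ i, h i ^ 2}
      ≤ ENNReal.ofReal (Real.exp (Fintype.card ι - t / 4)) := by
  have hb : ∏ _i : ι, ∫ x, Real.exp (x ^ 2 / 4) ∂stdGaussian ≤ Real.exp (Fintype.card ι) := by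
    rw [Finset.prod_const, ← mul_one (Fintype.card ι : ℝ), Real.exp_nat_mul]
    exact pow_le_pow_left₀ (integral_nonneg fun x => (Real.exp_pos _).le)
      integral_stdGaussian_exp_sq_le _
  refine (measure_mono fun h hh => ?_).trans
    (gaussianPi_prod_ge_le (fun (_ : ι) x => Real.exp (x ^ 2 / 4))
      (fun _ _ => (Real.exp_pos _).le) (fun _ => integrable_stdGaussian_exp_sq) (a := t / 4) hb)
  simp only [Set.mem_ofPred_eq] at hh ⊢
  rw [← Real.exp_sum, Real.exp_le_exp, ← Finset.sum_div]
  linarith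

/-- The squared distance of a standard gaussian vector to an affine subspace is rarely small. -/
lemma gaussianPi_dist_range_lt_le {M : Type*} [AddCommGroup M] [Module ℝ M]
    [FiniteDimensional ℝ M] (Φ : M →ₗ[ℝ] (ι → ℝ)) (w : ι → ℝ) (t L : ℝ) (hL : 0 ≤ L) :
    gaussianPi ι {h | ∃ z, ∑ i, (h i - w i - Φ z i) ^ 2 < t}
      ≤ ENNReal.ofReal (Real.exp (Real.exp (2 * L) / 2 * t
          - L * (Fintype.card ι - Module.finrank ℝ M))) := by
  let Ψ : M →ₗ[ℝ] EuclideanSpace ℝ ι := (WithLp.linearEquiv 2 ℝ (ι → ℝ)).symm.toLinearMap ∘ₗ Φ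
  let V : Submodule ℝ (EuclideanSpace ℝ ι) := LinearMap.range Ψ
  let b := stdOrthonormalBasis ℝ Vᗮ
  let u : Fin (Module.finrank ℝ Vᗮ) → EuclideanSpace ℝ ι := fun l => b l
  have hu : Orthonormal ℝ u := b.orthonormal.comp_linearIsometry Vᗮ.subtypeₗᵢ
  have hdim : (Fintype.card ι : ℝ) - Module.finrank ℝ M ≤ Module.finrank ℝ Vᗮ := by
    have h1 := V.finrank_add_finrank_orthogonal
    have h2 : Module.finrank ℝ V ≤ Module.finrank ℝ M := LinearMap.finrank_range_le Ψ
    have h3 : Module.finrank ℝ (EuclideanSpace ℝ ι) = Fintype.card ι := finrank_euclideanSpace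
    have : Fintype.card ι ≤ Module.finrank ℝ M + Module.finrank ℝ Vᗮ := by omega
    rw [sub_le_iff_le_add']
    exact_mod_cast this
  have hmeas : Measurable (fun (h : ι → ℝ) (l : Fin (Module.finrank ℝ Vᗮ)) => ∑ i, u l i * h i) :=
    by fun_prop
  have hb := gaussianPi_sum_sq_lt_le Finset.univ (fun l => ∑ i, u l i * w i) t L
  rw [← gaussianPi_map_orthonormal hu] at hb
  calc _ ≤ gaussianPi ι ((fun (h : ι → ℝ) (l : Fin (Module.finrank ℝ Vᗮ)) => ∑ i, u l i * h i) ⁻¹'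
        {g | ∑ l, (g l - ∑ i, u l i * w i) ^ 2 < t}) := by
        refine measure_mono ?_
        rintro h ⟨z, hz⟩
        refine lt_of_le_of_lt ?_ hz
        have hB := hu.sum_inner_products_le (s := Finset.univ)
          (WithLp.toLp 2 (fun i => h i - w i - Φ z i))
        rw [EuclideanSpace.real_norm_sq_eq] at hB
        refine le_trans (le_of_eq (Finset.sum_congr rfl fun l _ => ?_)) hB
        have horth : ∑ i, u l i * Φ z i = 0 := by
          have h0 : inner ℝ (Ψ z) (u l) = (0 : ℝ) :=
            (Submodule.mem_orthogonal _ _).1 (b l).2 _ (LinearMap.mem_range_self Ψ z)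
          simp only [PiLp.inner_apply, RCLike.inner_apply, conj_trivial] at h0
          exact h0
        rw [Real.norm_eq_abs, sq_abs]
        congr 1
        simp only [PiLp.inner_apply, RCLike.inner_apply, conj_trivial]
        rw [← Finset.sum_sub_distrib, ← sub_zero (∑ i, _), ← horth, ← Finset.sum_sub_distrib]
        exact Finset.sum_congr rfl fun i _ => by ring
    _ ≤ _ := Measure.le_map_apply hmeas.aemeasurable _
    _ ≤ _ := hb
    _ ≤ _ := by
        refine ENNReal.ofReal_le_ofReal (Real.exp_le_exp.2 ?_)
        rw [Finset.card_univ, Fintype.card_fin]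
        have := mul_le_mul_of_nonneg_left hdim hL
        linarith

lemma pi_gaussianPi_map_uncurry (α β : Type*) [Fintype α] [Fintype β] :
    (Measure.pi fun _ : α => gaussianPi β).map (fun A (p : α × β) => A p.1 p.2)
      = gaussianPi (α × β) := by
  symm
  refine Measure.pi_eq fun s hs => ?_
  rw [Measure.map_apply (by fun_prop) (.univ_pi hs)]
  have : (fun (A : α → β → ℝ) (p : α × β) => A p.1 p.2) ⁻¹' (Set.univ.pi s)
      = Set.univ.pi fun a => Set.univ.pi fun b => s (a, b) := by
    ext A
    simp [Set.mem_pi, Prod.forall]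
  rw [this, Measure.pi_pi]
  simp only [gaussianPi, Measure.pi_pi, Fintype.prod_prod_type]

/-- A linear form with unit coefficient vector maps i.i.d. standard gaussians to a standard
gaussian. -/
lemma gaussianPi_map_unit {ι : Type*} [Fintype ι] (e : ι → ℝ) (he : ∑ i, e i ^ 2 = 1) :
    (gaussianPi ι).map (fun h => ∑ i, e i * h i) = stdGaussian := by
  let u : Unit → EuclideanSpace ℝ ι := fun _ => WithLp.toLp 2 e
  have hu : Orthonormal ℝ u := by
    refine ⟨fun _ => ?_, fun i j hij => (hij (Subsingleton.elim i j)).elim⟩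
    have : ‖u ()‖ ^ 2 = 1 := by rw [EuclideanSpace.real_norm_sq_eq]; exact he
    nlinarith [norm_nonneg (u ())]
  have h1 : Measurable (fun (h : ι → ℝ) (l : Unit) => ∑ i, u l i * h i) := by fun_prop
  have h := congrArg (Measure.map fun g : Unit → ℝ => g ()) (gaussianPi_map_orthonormal hu)
  rw [Measure.map_map (by fun_prop) h1] at h
  refine Eq.trans h ?_
  exact (measurePreserving_eval (fun _ : Unit => stdGaussian) ()).map_eq

lemma measurePreserving_pi_prod {ι α : Type*} [Fintype ι] [MeasurableSpace α] (μ : Measure α)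
    [IsProbabilityMeasure μ] (f : ι → α × α → α)
    (hf : ∀ i, MeasurePreserving (f i) (μ.prod μ) μ) :
    MeasurePreserving (fun (p : (ι → α) × (ι → α)) i => f i (p.1 i, p.2 i))
      ((Measure.pi fun _ => μ).prod (Measure.pi fun _ => μ)) (Measure.pi fun _ => μ) := by
  have h1 := (measurePreserving_arrowProdEquivProdArrow α α ι (fun _ => μ) (fun _ => μ)).symm
  exact (measurePreserving_pi (fun _ => μ.prod μ) (fun _ => μ) hf).comp h1

/-- Resampling some columns of the gaussian matrices does not change their law. -/
lemma measurePreserving_resample_s5 (J m n : ℕ) (D : Finset (Fin n)) :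
    MeasurePreserving
      (fun (p : (Fin J → Fin m → Fin n → ℝ) × (Fin J → Fin m → Fin n → ℝ)) j r i =>
        if i ∈ D then p.2 j r i else p.1 j r i)
      ((Measure.pi fun _ : Fin J => Measure.pi fun _ : Fin m => gaussianPi (Fin n)).prod
        (Measure.pi fun _ : Fin J => Measure.pi fun _ : Fin m => gaussianPi (Fin n)))
      (Measure.pi fun _ : Fin J => Measure.pi fun _ : Fin m => gaussianPi (Fin n)) := by
  refine measurePreserving_pi_prod _
    (fun _ (p : (Fin m → Fin n → ℝ) × (Fin m → Fin n → ℝ)) r i =>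
      if i ∈ D then p.2 r i else p.1 r i) fun _ => ?_
  refine measurePreserving_pi_prod _
    (fun _ (p : (Fin n → ℝ) × (Fin n → ℝ)) i => if i ∈ D then p.2 i else p.1 i) fun _ => ?_
  refine measurePreserving_pi_prod _
    (fun i (p : ℝ × ℝ) => if i ∈ D then p.2 else p.1) fun i => ?_
  by_cases hi : i ∈ D
  · simpa [hi] using measurePreserving_snd (μ := stdGaussian) (ν := stdGaussian)
  · simpa [hi] using measurePreserving_fst (μ := stdGaussian) (ν := stdGaussian)

/-- Row-wise unit linear forms map gaussian matrices to a standard gaussian vector. -/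
lemma pi_gaussianPi_map_unit {J m n : ℕ} (e : Fin J → Fin n → ℝ)
    (he : ∀ j, ∑ i, e j i ^ 2 = 1) :
    (Measure.pi fun _ : Fin J => Measure.pi fun _ : Fin m => gaussianPi (Fin n)).map
      (fun B (p : Fin J × Fin m) => ∑ i, e p.1 i * B p.1 p.2 i) = gaussianPi (Fin J × Fin m) := by
  have hm : ∀ j, Measurable fun h : Fin n → ℝ => ∑ i, e j i * h i := fun j => by fun_prop
  have hm' : ∀ j, Measurable fun (b : Fin m → Fin n → ℝ) r => ∑ i, e j i * b r i :=
    fun j => by fun_prop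
  have hblock : ∀ j, (Measure.pi fun _ : Fin m => gaussianPi (Fin n)).map
      (fun b r => ∑ i, e j i * b r i) = gaussianPi (Fin m) := by
    intro j
    have := Measure.isProbabilityMeasure_map (μ := gaussianPi (Fin n)) (hm j).aemeasurable
    refine (Measure.pi_map_pi (μ := fun _ : Fin m => gaussianPi (Fin n))
      (f := fun (_ : Fin m) (h : Fin n → ℝ) => ∑ i, e j i * h i)
      (fun _ => (hm j).aemeasurable)).trans ?_
    simp only [gaussianPi_map_unit (e j) (he j)]
    rfl
  have h1 : (Measure.pi fun _ : Fin J => Measure.pi fun _ : Fin m => gaussianPi (Fin n)).map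
      (fun B j r => ∑ i, e j i * B j r i) = Measure.pi fun _ : Fin J => gaussianPi (Fin m) := by
    have := fun j => Measure.isProbabilityMeasure_map
      (μ := Measure.pi fun _ : Fin m => gaussianPi (Fin n)) (hm' j).aemeasurable
    refine (Measure.pi_map_pi
      (μ := fun _ : Fin J => Measure.pi fun _ : Fin m => gaussianPi (Fin n))
      (f := fun (j : Fin J) (b : Fin m → Fin n → ℝ) r => ∑ i, e j i * b r i)
      (fun j => (hm' j).aemeasurable)).trans ?_
    simp only [hblock]
  rw [← pi_gaussianPi_map_uncurry, ← h1, Measure.map_map (by fun_prop) (by fun_prop)]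
  rfl

lemma prod_le_of_forall_slice_le {α β : Type*} [MeasurableSpace α] [MeasurableSpace β]
    (μ : Measure α) (ν : Measure β) [IsProbabilityMeasure μ] [SFinite ν] {s : Set (α × β)}
    (hs : MeasurableSet s) {b : ℝ≥0∞} (h : ∀ x, ν {y | (x, y) ∈ s} ≤ b) : μ.prod ν s ≤ b := by
  rw [Measure.prod_apply hs]
  calc _ ≤ ∫⁻ _, b ∂μ := lintegral_mono h
    _ = b := by simp

/-- Small ball estimate for gaussian mixtures modulo a subspace. -/
lemma matrix_dist_range_lt_le {J m n : ℕ} {M : Type*} [AddCommGroup M] [Module ℝ M]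
    [FiniteDimensional ℝ M] (Φ : M →ₗ[ℝ] (Fin J × Fin m → ℝ)) (w : Fin J × Fin m → ℝ)
    (y : Fin J → Fin n → ℝ) {c : ℝ} (hc : 0 < c) (hy : ∀ j, c ≤ ∑ i, y j i ^ 2)
    (t L : ℝ) (hL : 0 ≤ L) :
    (Measure.pi fun _ : Fin J => Measure.pi fun _ : Fin m => gaussianPi (Fin n))
      {B | ∃ z, ∑ j, ∑ r, (∑ i, B j r i * y j i - w (j, r) - Φ z (j, r)) ^ 2 < t}
      ≤ ENNReal.ofReal (Real.exp (Real.exp (2 * L) / 2 * (t / c)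
          - L * (J * m - Module.finrank ℝ M))) := by
  set q : Fin J → ℝ := fun j => √(∑ i, y j i ^ 2) with hq
  have hq2 : ∀ j, q j ^ 2 = ∑ i, y j i ^ 2 := fun j => Real.sq_sqrt (hc.le.trans (hy j))
  have hq0 : ∀ j, 0 < q j := fun j => Real.sqrt_pos.2 (hc.trans_le (hy j))
  let g : (Fin J → Fin m → Fin n → ℝ) → (Fin J × Fin m → ℝ) :=
    fun B p => ∑ i, (y p.1 i / q p.1) * B p.1 p.2 i
  have hg : Measurable g := by fun_prop
  have hlaw : (Measure.pi fun _ : Fin J => Measure.pi fun _ : Fin m => gaussianPi (Fin n)).map g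
      = gaussianPi (Fin J × Fin m) := by
    refine pi_gaussianPi_map_unit (fun j i => y j i / q j) fun j => ?_
    simp only [div_pow]
    rw [← Finset.sum_div, hq2, div_self (hc.trans_le (hy j)).ne']
  let D : (Fin J × Fin m → ℝ) →ₗ[ℝ] (Fin J × Fin m → ℝ) :=
    LinearMap.pi fun p => (q p.1)⁻¹ • LinearMap.proj p
  have hb := gaussianPi_dist_range_lt_le (D ∘ₗ Φ) (fun p => w p / q p.1) (t / c) L hL
  rw [← hlaw] at hb
  refine (le_trans ?_ (Measure.le_map_apply hg.aemeasurable _)).trans (hb.trans (le_of_eq ?_))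
  · refine measure_mono ?_
    rintro B ⟨z, hz⟩
    refine ⟨z, ?_⟩
    rw [lt_div_iff₀ hc, mul_comm, Fintype.sum_prod_type, Finset.mul_sum]
    refine lt_of_le_of_lt (Finset.sum_le_sum fun j _ => ?_) hz
    rw [Finset.mul_sum]
    refine Finset.sum_le_sum fun r _ => ?_
    have h1 : ∑ i, B j r i * y j i - w (j, r) - Φ z (j, r)
        = q j * (g B (j, r) - w (j, r) / q j - (D ∘ₗ Φ) z (j, r)) := by
      have h2 : g B (j, r) = (∑ i, B j r i * y j i) / q j := by
        simp only [g, Finset.sum_div]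
        exact Finset.sum_congr rfl fun i _ => by ring
      have h3 : (D ∘ₗ Φ) z (j, r) = (q j)⁻¹ * Φ z (j, r) := by simp [D]
      rw [h2, h3]
      have := (hq0 j).ne'
      field_simp
    rw [h1, mul_pow]
    refine mul_le_mul_of_nonneg_right ?_ (sq_nonneg _)
    rw [hq2]
    exact hy j
  · rw [Fintype.card_prod, Fintype.card_fin, Fintype.card_fin]
    push_cast
    rfl

lemma sum_mul_signal {n : ℕ} (S : Finset (Fin n)) (a x : Fin n → ℝ) :
    ∑ i, a i * signal n S x i = ∑ i ∈ S, a i * x i := by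
  simp only [signal, mul_ite, mul_zero, Finset.sum_ite_mem, Finset.univ_inter]

/-- The pattern `T` explains the observations with squared residual smaller than `t`. -/
def Explains (n m J : ℕ) (SNR : ℝ) (k : ℕ) (t : ℝ) (Y : Fin J → Fin m → ℝ)
    (A : Fin J → Fin m → Fin n → ℝ) (T : Finset (Fin n)) : Prop :=
  ∃ x : Fin J → Fin n → ℝ,
    ∑ j, ∑ r, (Y j r - √(SNR / k) * ∑ i, A j r i * signal n T (x j) i) ^ 2 < t

/-- An estimator returning some size-`k` pattern that explains the observations. -/
def residualEstimator (n m J : ℕ) (SNR : ℝ) (k : ℕ) (t : ℝ) : Estimator n m J :=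
  open Classical in fun Y A =>
    if h : ∃ T ∈ patterns n k, Explains n m J SNR k t Y A T then h.choose else ∅

instance (n m J : ℕ) : IsProbabilityMeasure (omegaLaw n m J) := by
  unfold omegaLaw; infer_instance

lemma isOpen_explains (n m J : ℕ) (SNR : ℝ) (k : ℕ) (t : ℝ) (S T : Finset (Fin n)) :
    IsOpen {ω : Omega n m J | Explains n m J SNR k t (Yobs n m J SNR k S ω) ω.2.1 T} := by
  have : {ω : Omega n m J | Explains n m J SNR k t (Yobs n m J SNR k S ω) ω.2.1 T}
      = ⋃ x : Fin J → Fin n → ℝ, {ω : Omega n m J |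
        ∑ j, ∑ r, ((√(SNR / k) * (∑ i ∈ S, ω.2.1 j r i * ω.1 j i) + ω.2.2 j r)
          - √(SNR / k) * ∑ i ∈ T, ω.2.1 j r i * x j i) ^ 2 < t} := by
    ext ω
    simp only [Explains, Yobs, sum_mul_signal, Set.mem_ofPred_eq, Set.mem_iUnion]
  rw [this]
  exact isOpen_iUnion fun x => isOpen_lt (by fun_prop) continuous_const

/-- Given the signal and the noise, a wrong pattern rarely explains the observations. -/
lemma matrixLaw_explains_le (n m J k : ℕ) {SNR β : ℝ} (hSNR : 0 < SNR) (hβ : 0 < β) (hk : 0 < k)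
    (t L : ℝ) (hL : 0 ≤ L) (S T : Finset (Fin n)) (hT : #T = k) (X : Fin J → Fin n → ℝ)
    (hX : ∀ j, β * k ≤ ∑ i ∈ S \ T, X j i ^ 2) (W : Fin J → Fin m → ℝ) :
    (Measure.pi fun _ : Fin J => Measure.pi fun _ : Fin m => gaussianPi (Fin n))
      {A | Explains n m J SNR k t (Yobs n m J SNR k S (X, A, W)) A T}
      ≤ ENNReal.ofReal (Real.exp (Real.exp (2 * L) / 2 * (t / (SNR * β))
          - L * (J * m - J * k))) := by
  have hk' : (0 : ℝ) < k := by exact_mod_cast hk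
  have hmeas : MeasurableSet
      {A | Explains n m J SNR k t (Yobs n m J SNR k S (X, A, W)) A T} :=
    ((isOpen_explains n m J SNR k t S T).preimage
      (f := fun A : Fin J → Fin m → Fin n → ℝ => (X, A, W)) (by fun_prop)).measurableSet
  have hres := measurePreserving_resample_s5 J m n (S \ T)
  rw [← hres.measure_preimage hmeas.nullMeasurableSet]
  refine prod_le_of_forall_slice_le _ _ (hmeas.preimage hres.measurable) fun A => ?_
  let Φ : (Fin J × T → ℝ) →ₗ[ℝ] (Fin J × Fin m → ℝ) :=
    LinearMap.pi fun p => √(SNR / k) • ∑ i : T, A p.1 p.2 i • LinearMap.proj (p.1, i)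
  let y : Fin J → Fin n → ℝ := fun j i => if i ∈ S \ T then √(SNR / k) * X j i else 0
  let w : Fin J × Fin m → ℝ :=
    fun p => -(√(SNR / k) * ∑ i ∈ S ∩ T, A p.1 p.2 i * X p.1 i + W p.1 p.2)
  have hy : ∀ j, SNR * β ≤ ∑ i, y j i ^ 2 := by
    intro j
    have h1 : ∑ i, y j i ^ 2 = SNR / k * ∑ i ∈ S \ T, X j i ^ 2 := by
      simp only [y, ite_pow, ne_eq, OfNat.ofNat_ne_zero, not_false_eq_true, zero_pow,
        Finset.sum_ite_mem, Finset.univ_inter, mul_pow,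
        Real.sq_sqrt (div_pos hSNR hk').le, Finset.mul_sum]
    rw [h1]
    calc SNR * β = SNR / k * (β * k) := by field_simp
      _ ≤ _ := mul_le_mul_of_nonneg_left (hX j) (div_pos hSNR hk').le
  have hmain := matrix_dist_range_lt_le Φ w y (mul_pos hSNR hβ) hy t L hL
  rw [Module.finrank_fintype_fun_eq_card, Fintype.card_prod, Fintype.card_fin, Fintype.card_coe,
    hT] at hmain
  push_cast at hmain
  refine (measure_mono ?_).trans hmain
  rintro B ⟨x, hx⟩
  refine ⟨fun p => x p.1 p.2, lt_of_le_of_lt (le_of_eq ?_) hx⟩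
  refine Finset.sum_congr rfl fun j _ => Finset.sum_congr rfl fun r _ => ?_
  congr 1
  simp only [Yobs, sum_mul_signal]
  have hΦ : Φ (fun p => x p.1 p.2) (j, r) = √(SNR / k) * ∑ i ∈ T, A j r i * x j i := by
    simp only [Φ, LinearMap.pi_apply, LinearMap.smul_apply, LinearMap.sum_apply,
      LinearMap.proj_apply, smul_eq_mul]
    rw [← Finset.sum_coe_sort T]
  have hT' : ∑ i ∈ T, (if i ∈ S \ T then B j r i else A j r i) * x j i
      = ∑ i ∈ T, A j r i * x j i :=
    Finset.sum_congr rfl fun i hi => by simp [hi]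
  have hS' : ∑ i ∈ S, (if i ∈ S \ T then B j r i else A j r i) * X j i
      = ∑ i ∈ S \ T, B j r i * X j i + ∑ i ∈ S ∩ T, A j r i * X j i := by
    rw [← Finset.sum_sdiff (Finset.inter_subset_left : S ∩ T ⊆ S), Finset.sdiff_inter_self_left]
    congr 1
    · exact Finset.sum_congr rfl fun i hi => by rw [if_pos hi]
    · exact Finset.sum_congr rfl fun i hi => by
        simp [(Finset.mem_inter.1 hi).2]
  have hy' : ∑ i, B j r i * y j i = √(SNR / k) * ∑ i ∈ S \ T, B j r i * X j i := by
    simp only [y, mul_ite, mul_zero, Finset.sum_ite_mem, Finset.univ_inter, Finset.mul_sum]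
    exact Finset.sum_congr rfl fun i _ => by ring
  rw [hΦ, hT', hS', hy']
  simp only [w]
  ring

lemma omegaLaw_fst_apply_lt_le (n m J : ℕ) (U : Finset (Fin n)) (j : Fin J) (t L : ℝ) :
    omegaLaw n m J {ω | ∑ i ∈ U, ω.1 j i ^ 2 < t}
      ≤ ENNReal.ofReal (Real.exp (Real.exp (2 * L) / 2 * t - L * #U)) := by
  have h1 : MeasurePreserving (fun ω : Omega n m J => ω.1 j) (omegaLaw n m J)
      (gaussianPi (Fin n)) :=
    (measurePreserving_eval (fun _ : Fin J => gaussianPi (Fin n)) j).comp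
      measurePreserving_fst
  have hm : MeasurableSet {h : Fin n → ℝ | ∑ i ∈ U, h i ^ 2 < t} :=
    (isOpen_lt (by fun_prop) continuous_const).measurableSet
  have h2 := gaussianPi_sum_sq_lt_le U 0 t L
  simp only [Pi.zero_apply, sub_zero] at h2
  rw [← h1.measure_preimage hm.nullMeasurableSet] at h2
  exact h2

lemma omegaLaw_noise_ge_le (n m J : ℕ) (t : ℝ) :
    omegaLaw n m J {ω | t ≤ ∑ j, ∑ r, ω.2.2 j r ^ 2}
      ≤ ENNReal.ofReal (Real.exp (J * m - t / 4)) := by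
  have h0 : MeasurePreserving (fun (A : Fin J → Fin m → ℝ) (p : Fin J × Fin m) => A p.1 p.2)
      (Measure.pi fun _ => gaussianPi (Fin m)) (gaussianPi (Fin J × Fin m)) :=
    ⟨by fun_prop, pi_gaussianPi_map_uncurry _ _⟩
  have h1 : MeasurePreserving (fun (ω : Omega n m J) (p : Fin J × Fin m) => ω.2.2 p.1 p.2)
      (omegaLaw n m J) (gaussianPi (Fin J × Fin m)) :=
    h0.comp (measurePreserving_snd.comp measurePreserving_snd)
  have hm : MeasurableSet {h : Fin J × Fin m → ℝ | t ≤ ∑ p, h p ^ 2} :=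
    (isClosed_le continuous_const (by fun_prop)).measurableSet
  have h2 := gaussianPi_sum_sq_ge_le (ι := Fin J × Fin m) t
  rw [← h1.measure_preimage hm.nullMeasurableSet] at h2
  simpa [Fintype.sum_prod_type] using h2

lemma omegaLaw_explains_le (n m J k : ℕ) {SNR β : ℝ} (hSNR : 0 < SNR) (hβ : 0 < β) (hk : 0 < k)
    (t L₁ L : ℝ) (hL : 0 ≤ L) (S T : Finset (Fin n)) (hT : #T = k) :
    omegaLaw n m J {ω | Explains n m J SNR k t (Yobs n m J SNR k S ω) ω.2.1 T}
      ≤ J * ENNReal.ofReal (Real.exp (Real.exp (2 * L₁) / 2 * (β * k) - L₁ * #(S \ T)))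
        + ENNReal.ofReal (Real.exp (Real.exp (2 * L) / 2 * (t / (SNR * β))
          - L * (J * m - J * k))) := by
  set E := {ω : Omega n m J | Explains n m J SNR k t (Yobs n m J SNR k S ω) ω.2.1 T} with hE
  let G : Fin J → Set (Omega n m J) := fun j => {ω | ∑ i ∈ S \ T, ω.1 j i ^ 2 < β * k}
  have hEm : MeasurableSet E := (isOpen_explains n m J SNR k t S T).measurableSet
  have hGm : ∀ j, MeasurableSet (G j) := fun j =>
    (isOpen_lt (by fun_prop) continuous_const).measurableSet
  have hsub : E ⊆ (⋃ j, G j) ∪ (E \ ⋃ j, G j) := fun ω hω => by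
    by_cases h : ω ∈ ⋃ j, G j
    · exact Or.inl h
    · exact Or.inr ⟨hω, h⟩
  refine (measure_mono hsub).trans ((measure_union_le _ _).trans (add_le_add ?_ ?_))
  · refine (measure_iUnion_fintype_le _ _).trans ?_
    refine (Finset.sum_le_sum fun j _ =>
      omegaLaw_fst_apply_lt_le n m J (S \ T) j (β * k) L₁).trans (le_of_eq ?_)
    simp
  · have hm : MeasurableSet (E \ ⋃ j, G j) := hEm.diff (MeasurableSet.iUnion hGm)
    refine prod_le_of_forall_slice_le _ _ hm fun X => ?_
    by_cases hX : ∀ j, β * k ≤ ∑ i ∈ S \ T, X j i ^ 2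
    · refine (measure_mono (t := {p | (X, p) ∈ E}) fun p hp => hp.1).trans ?_
      have hm' : MeasurableSet {p | (X, p) ∈ E} := hEm.preimage measurable_prodMk_left
      rw [← Measure.measurePreserving_swap.measure_preimage hm'.nullMeasurableSet]
      exact prod_le_of_forall_slice_le _ _ (hm'.preimage measurable_swap) fun W =>
        matrixLaw_explains_le n m J k hSNR hβ hk t L hL S T hT X hX W
    · push Not at hX
      obtain ⟨j, hj⟩ := hX
      have : {p | (X, p) ∈ E \ ⋃ j, G j} = ∅ := by
        ext p
        simp only [Set.mem_ofPred_eq, Set.mem_sdiff, Set.mem_iUnion, Set.mem_empty_iff_false,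
          iff_false, not_and, not_not]
        exact fun _ => ⟨j, hj⟩
      rw [this]
      simp

/-- Nonasymptotic error bound for the residual estimator. -/
lemma errProb_residualEstimator_le (n m J k : ℕ) {SNR β α : ℝ} (hSNR : 0 < SNR) (hβ : 0 < β)
    (hk : 0 < k) (hkn : k ≤ n) (t L₁ L : ℝ) (hL₁ : 0 ≤ L₁) (hL : 0 ≤ L) :
    errProb n m J k SNR α (residualEstimator n m J SNR k t)
      ≤ Real.exp (J * m - t / 4)
        + n.choose k * (J * Real.exp (Real.exp (2 * L₁) / 2 * (β * k) - L₁ * (α * k))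
          + Real.exp (Real.exp (2 * L) / 2 * (t / (SNR * β)) - L * (J * m - J * k))) := by
  have hk' : (0 : ℝ) < k := by exact_mod_cast hk
  set b₁ := Real.exp (Real.exp (2 * L₁) / 2 * (β * k) - L₁ * (α * k)) with hb₁
  set b₂ := Real.exp (Real.exp (2 * L) / 2 * (t / (SNR * β)) - L * (J * m - J * k)) with hb₂
  have hcard : #(patterns n k) = n.choose k := by
    rw [patterns, Finset.card_powersetCard, Finset.card_univ, Fintype.card_fin]
  have hchoose : (0 : ℝ) < n.choose k := by exact_mod_cast Nat.choose_pos hkn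
  have hS : ∀ S ∈ patterns n k, (omegaLaw n m J {ω | α < distor k S
      (residualEstimator n m J SNR k t (Yobs n m J SNR k S ω) ω.2.1)}).toReal
      ≤ Real.exp (J * m - t / 4) + n.choose k * (J * b₁ + b₂) := by
    intro S hSmem
    have hScard : #S = k := (Finset.mem_powersetCard.1 hSmem).2
    refine ENNReal.toReal_le_of_le_ofReal (by positivity) ?_
    let F : Finset (Finset (Fin n)) := (patterns n k).filter fun T => α * k < #(S \ T)
    have hsub : {ω | α < distor k S
        (residualEstimator n m J SNR k t (Yobs n m J SNR k S ω) ω.2.1)}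
        ⊆ {ω | t ≤ ∑ j, ∑ r, ω.2.2 j r ^ 2} ∪
          ⋃ T ∈ F, {ω | Explains n m J SNR k t (Yobs n m J SNR k S ω) ω.2.1 T} := by
      intro ω hω
      by_cases hW : t ≤ ∑ j, ∑ r, ω.2.2 j r ^ 2
      · exact Or.inl hW
      right
      have hex : ∃ T ∈ patterns n k,
          Explains n m J SNR k t (Yobs n m J SNR k S ω) ω.2.1 T := by
        refine ⟨S, hSmem, ω.1, ?_⟩
        simp only [Yobs, add_sub_cancel_left]
        exact not_le.1 hW
      simp only [Set.mem_ofPred_eq, residualEstimator, dif_pos hex] at hω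
      have hT := hex.choose_spec
      set T := hex.choose
      have hTcard : #T = k := (Finset.mem_powersetCard.1 hT.1).2
      refine Set.mem_iUnion₂.2 ⟨T, Finset.mem_filter.2 ⟨hT.1, ?_⟩, hT.2⟩
      rw [distor, Finset.card_sdiff_comm (hScard.trans hTcard.symm), max_self,
        lt_div_iff₀ hk'] at hω
      rwa [Finset.card_sdiff_comm (hScard.trans hTcard.symm)]
    calc _ ≤ omegaLaw n m J {ω | t ≤ ∑ j, ∑ r, ω.2.2 j r ^ 2} + ∑ T ∈ F,
          omegaLaw n m J {ω | Explains n m J SNR k t (Yobs n m J SNR k S ω) ω.2.1 T} :=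
          (measure_mono hsub).trans ((measure_union_le _ _).trans
            (add_le_add le_rfl (measure_biUnion_finset_le _ _)))
      _ ≤ ENNReal.ofReal (Real.exp (J * m - t / 4))
          + ∑ T ∈ F, ENNReal.ofReal (J * b₁ + b₂) := by
          refine add_le_add (omegaLaw_noise_ge_le n m J t) (Finset.sum_le_sum fun T hT => ?_)
          obtain ⟨hT1, hT2⟩ := Finset.mem_filter.1 hT
          refine (omegaLaw_explains_le n m J k hSNR hβ hk t L₁ L hL S T
            (Finset.mem_powersetCard.1 hT1).2).trans ?_
          rw [ENNReal.ofReal_add (by positivity) (by positivity),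
            ENNReal.ofReal_mul (by positivity), ENNReal.ofReal_natCast]
          gcongr
          rw [hb₁]
          gcongr
      _ ≤ ENNReal.ofReal (Real.exp (J * m - t / 4))
          + ENNReal.ofReal (n.choose k * (J * b₁ + b₂)) := by
          rw [Finset.sum_const, nsmul_eq_mul, ENNReal.ofReal_mul (by positivity),
            ENNReal.ofReal_natCast]
          gcongr
          exact (Finset.card_filter_le _ _).trans hcard.le
      _ = _ := (ENNReal.ofReal_add (by positivity) (by positivity)).symm
  unfold errProb
  refine (mul_le_mul_of_nonneg_left (Finset.sum_le_sum hS) (by positivity)).trans (le_of_eq ?_)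
  rw [Finset.sum_const, hcard, nsmul_eq_mul, inv_mul_cancel_left₀ hchoose.ne']

lemma Hb_pos {p : ℝ} (h0 : 0 < p) (h1 : p < 1) : 0 < Hb p := by
  have h2 := mul_neg_of_pos_of_neg h0 (Real.log_neg h0 h1)
  have h3 := mul_neg_of_pos_of_neg (sub_pos.2 h1) (Real.log_neg (sub_pos.2 h1) (by linarith))
  unfold Hb
  linarith

lemma choose_le_exp {κ : ℝ} (h0 : 0 < κ) (h1 : κ < 1) {n k : ℕ} (hkn : k ≤ n) :
    (n.choose k : ℝ) ≤ Real.exp (-(k * Real.log κ) - (n - k) * Real.log (1 - κ)) := by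
  have h1' : 0 < 1 - κ := by linarith
  have hsum := add_pow κ (1 - κ) n
  rw [add_sub_cancel, one_pow] at hsum
  have hterm : κ ^ k * (1 - κ) ^ (n - k) * n.choose k ≤ 1 := by
    have hle := Finset.single_le_sum (s := Finset.range (n + 1))
      (f := fun i => κ ^ i * (1 - κ) ^ (n - i) * (n.choose i : ℝ))
      (fun i _ => by positivity) (Finset.mem_range.2 (Nat.lt_succ_of_le hkn))
    exact hle.trans hsum.ge
  have hexp : Real.exp (-(k * Real.log κ) - (n - k) * Real.log (1 - κ))
      = (κ ^ k * (1 - κ) ^ (n - k))⁻¹ := by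
    rw [← Nat.cast_sub hkn, ← neg_add', Real.exp_neg, Real.exp_add, Real.exp_nat_mul,
      Real.exp_nat_mul, Real.exp_log h0, Real.exp_log h1']
  rw [hexp, ← one_div, le_div_iff₀' (by positivity)]
  exact hterm

lemma tendsto_exp_of_div_neg {f : ℕ → ℝ} {a : ℝ} (ha : a < 0)
    (hf : Tendsto (fun n => f n / n) atTop (𝓝 a)) :
    Tendsto (fun n => Real.exp (f n)) atTop (𝓝 0) := by
  refine Real.tendsto_exp_atBot.comp ?_
  refine (hf.neg_mul_atTop ha tendsto_natCast_atTop_atTop).congr' ?_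
  filter_upwards [eventually_gt_atTop 0] with n hn
  have : (n : ℝ) ≠ 0 := by exact_mod_cast hn.ne'
  field_simp

/-- A total sampling rate is achievable as soon as the three exponents governing the error of the
residual estimator are negative. -/
lemma achievable_of_exponents_neg {κ SNR ρ α β θ L₁ L : ℝ} {J : ℕ} (hJ : 1 ≤ J) (hκ0 : 0 < κ)
    (hκ1 : κ < 1) (hSNR : 0 < SNR) (hβ : 0 < β) (hL₁ : 0 ≤ L₁) (hL : 0 ≤ L) (hρ : J * κ ≤ ρ)
    (h₁ : ρ - θ / 4 < 0)
    (h₂ : Hb κ + (Real.exp (2 * L₁) / 2 * (β * κ) - L₁ * (α * κ)) < 0)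
    (h₃ : Hb κ + (Real.exp (2 * L) / 2 * (θ / (SNR * β)) - L * (ρ - J * κ)) < 0) :
    achievable κ SNR ρ J α := by
  have hJ' : (0 : ℝ) < J := by exact_mod_cast hJ
  let k : ℕ → ℕ := fun n => ⌊κ * n⌋₊
  let m : ℕ → ℕ := fun n => ⌊ρ / J * n⌋₊
  have hρ0 : 0 ≤ ρ := le_trans (by positivity) hρ
  have hk : Tendsto (fun n => (k n : ℝ) / n) atTop (𝓝 κ) :=
    (tendsto_nat_floor_mul_div_atTop hκ0.le).comp tendsto_natCast_atTop_atTop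
  have hm : Tendsto (fun n => (J : ℝ) * m n / n) atTop (𝓝 ρ) := by
    have := ((tendsto_nat_floor_mul_div_atTop (div_nonneg hρ0 hJ'.le)).comp
      tendsto_natCast_atTop_atTop).const_mul (J : ℝ)
    rw [mul_div_cancel₀ _ hJ'.ne'] at this
    exact this.congr fun n => by simp [m, mul_div_assoc]
  have hkn : ∀ n, k n ≤ n := fun n => by
    refine Nat.floor_le_of_le ?_
    exact mul_le_of_le_one_left (Nat.cast_nonneg n) hκ1.le
  have hk0 : ∀ᶠ n in atTop, 0 < k n := by
    have h : Tendsto (fun n : ℕ => κ * n) atTop atTop :=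
      tendsto_natCast_atTop_atTop.const_mul_atTop hκ0
    filter_upwards [h.eventually_ge_atTop 1] with n hn
    exact Nat.floor_pos.2 hn
  have hone : Tendsto (fun n : ℕ => (n : ℝ) / n) atTop (𝓝 1) :=
    tendsto_const_nhds.congr' (by
      filter_upwards [eventually_gt_atTop 0] with n hn
      exact (div_self (by exact_mod_cast hn.ne')).symm)
  let ent : ℕ → ℝ := fun n => -(k n * Real.log κ) - (n - k n) * Real.log (1 - κ)
  have hent : Tendsto (fun n => ent n / n) atTop (𝓝 (Hb κ)) := by
    refine ((hk.mul_const (Real.log κ)).neg.sub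
      ((hone.sub hk).mul_const (Real.log (1 - κ)))).congr fun n => ?_
    simp only [ent]
    ring
  have t₁ : Tendsto (fun n => Real.exp (J * m n - θ * n / 4)) atTop (𝓝 0) := by
    refine tendsto_exp_of_div_neg h₁ ?_
    have := hm.sub (hone.const_mul (θ / 4))
    rw [mul_one] at this
    exact this.congr fun n => by ring
  have t₂ : Tendsto (fun n => Real.exp (ent n + (Real.exp (2 * L₁) / 2 * (β * k n)
      - L₁ * (α * k n)))) atTop (𝓝 0) := by
    refine tendsto_exp_of_div_neg h₂ ?_
    exact (hent.add (((hk.const_mul β).const_mul (Real.exp (2 * L₁) / 2)).sub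
      ((hk.const_mul α).const_mul L₁))).congr fun n => by ring
  have t₃ : Tendsto (fun n => Real.exp (ent n + (Real.exp (2 * L) / 2 * (θ * n / (SNR * β))
      - L * (J * m n - J * k n)))) atTop (𝓝 0) := by
    refine tendsto_exp_of_div_neg h₃ ?_
    have := hent.add (((hone.const_mul (θ / (SNR * β))).const_mul (Real.exp (2 * L) / 2)).sub
      ((hm.sub (hk.const_mul (J : ℝ))).const_mul L))
    rw [mul_one] at this
    exact this.congr fun n => by ring
  refine ⟨k, m, fun n => residualEstimator n (m n) J SNR (k n) (θ * n), hk, hm, ?_⟩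
  have hlim := t₁.add ((t₂.const_mul (J : ℝ)).add t₃)
  simp only [mul_zero, add_zero] at hlim
  refine tendsto_of_tendsto_of_tendsto_of_le_of_le' tendsto_const_nhds hlim
    (Eventually.of_forall fun n => ?_) ?_
  · exact mul_nonneg (by positivity) (Finset.sum_nonneg fun _ _ => ENNReal.toReal_nonneg)
  · filter_upwards [hk0] with n hn
    refine (errProb_residualEstimator_le n (m n) J (k n) hSNR hβ hn (hkn n) (θ * n) L₁ L
      hL₁ hL).trans ?_
    refine add_le_add le_rfl ?_
    refine (mul_le_mul_of_nonneg_right (choose_le_exp hκ0 hκ1 (hkn n)) (by positivity)).trans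
      (le_of_eq ?_)
    simp only [ent, Real.exp_add]
    ring

/-- **Theorem 4(a)** (High-SNR achievability). For fixed `κ`, `J` and target distortion
`α > 0`, the minimal total sampling rate satisfies
`ρ(SNR) ≤ Jκ + 2·H_b(κ)(1+ε)/log SNR` for all large enough `SNR`. -/
theorem high_snr_achievability
    (κ α : ℝ) (J : ℕ) (hJ : 1 ≤ J)
    (hκ : κ ∈ Set.Ioo 0 (1/2)) (hα : 0 < α) :
    ∀ ε > (0:ℝ), ∃ SNR₀ : ℝ, ∀ SNR ≥ SNR₀,
      rhoStar κ SNR J α ≤ J * κ + 2 * Hb κ * (1 + ε) / Real.log SNR := by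
  intro ε hε
  obtain ⟨hκ0, hκ2⟩ := hκ
  have hJ' : (1 : ℝ) ≤ J := by exact_mod_cast hJ
  have hh : 0 < Hb κ := Hb_pos hκ0 (by linarith)
  set h := Hb κ with hh_def
  set θ : ℝ := 4 * (J + 2) with hθ
  set L₁ : ℝ := (h + 2) / (α * κ) with hL₁
  set β : ℝ := 2 * Real.exp (-(2 * L₁)) with hβ
  set L₀ : ℝ := Real.log (2 * θ / (β * (h * ε))) / 2 with hL₀
  have hθ0 : 0 < θ := by positivity
  have hβ0 : 0 < β := by positivity
  set N : ℝ := 1 + 2 * h * (1 + ε) + 2 * |L₀| + 16 * |L₀| * (1 + ε) / ε with hN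
  refine ⟨Real.exp N, fun SNR hS => ?_⟩
  have hSNR : 0 < SNR := (Real.exp_pos _).trans_le hS
  have hlog : N ≤ Real.log SNR := (Real.le_log_iff_exp_le hSNR).2 hS
  set l := Real.log SNR with hl
  have hpos1 : 0 ≤ 2 * h * (1 + ε) := by positivity
  have hpos2 : 0 ≤ 16 * |L₀| * (1 + ε) / ε := by positivity
  have hl0 : 0 < l := by linarith [abs_nonneg L₀]
  have hδ0 : 0 ≤ 2 * h * (1 + ε) / l := by positivity
  have hδ1 : 2 * h * (1 + ε) / l ≤ 1 := by
    rw [div_le_one hl0]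
    linarith [abs_nonneg L₀]
  refine csInf_le ⟨0, fun ρ hρ => ?_⟩ ?_
  · obtain ⟨k, m, est, -, hm, -⟩ := hρ
    exact ge_of_tendsto' hm fun n => by positivity
  refine achievable_of_exponents_neg (β := β) (θ := θ) (L₁ := L₁) (L := l / 2 - L₀) hJ hκ0
    (by linarith) hSNR hβ0 (by positivity) ?_ (by linarith) ?_ ?_ ?_
  · linarith [le_abs_self L₀, abs_nonneg L₀]
  · have : (J : ℝ) * κ ≤ J := mul_le_of_le_one_right (by linarith) (by linarith)
    linarith
  · have h1 : Real.exp (2 * L₁) / 2 * (β * κ) = κ := by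
      rw [hβ, Real.exp_neg]
      field_simp
    have h2 : L₁ * (α * κ) = h + 2 := by
      rw [hL₁]
      field_simp
    rw [h1, h2]
    linarith
  · have h1 : Real.exp (2 * (l / 2 - L₀)) / 2 * (θ / (SNR * β)) = h * ε / 4 := by
      have h2 : 2 * (l / 2 - L₀) = l - Real.log (2 * θ / (β * (h * ε))) := by
        rw [hL₀]; ring
      rw [h2, Real.exp_sub, Real.exp_log hSNR, Real.exp_log (by positivity)]
      field_simp
      norm_num
    have h3 : (l / 2 - L₀) * (J * κ + 2 * h * (1 + ε) / l - J * κ)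
        = h * (1 + ε) - h * (2 * L₀ * (1 + ε) / l) := by
      field_simp
      ring
    have h4 : 2 * L₀ * (1 + ε) / l ≤ ε / 8 := by
      rw [div_le_iff₀ hl0]
      have h5 : 16 * |L₀| * (1 + ε) / ε ≤ l := by linarith [abs_nonneg L₀]
      rw [div_le_iff₀ hε] at h5
      have h6 : L₀ * (1 + ε) ≤ |L₀| * (1 + ε) :=
        mul_le_mul_of_nonneg_right (le_abs_self _) (by linarith)
      linarith
    rw [h1, h3]
    nlinarith [mul_le_mul_of_nonneg_left h4 hh.le, mul_pos hh hε]

end Sparsity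
end
end
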